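/- If a triangulation of a surface contains a vertex v such that no edge incident to v is contractible and no edge of lk(v) is contractible (in the sense that all these edges lie on nonfacial 3-cycles that do not involve cutting data), then in an irreducible triangulation T, for any vertex v, there exist indices i ≠ j with 1 ≤ i < j ≤ 3 such that v lies on 3-cycles through two distinct pairs of opposite link vertices; concretely: there exist four distinct neighbors y1, y2, y3, y4 of v occurring in this cyclic order on lk(v) with both v y1 y3 and v y2 y4 nonfacial 3-cycles. -/

import Mathlib

open Finset

open scoped Classical

/-! Combinatorial model of triangulations of closed surfaces.
A triangulation is encoded by its finite set of triangular faces (3-element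
vertex sets).  Surface-ness is expressed by: every edge lies in exactly two
faces, the link of every vertex is connected (hence a single cycle), and the
whole complex is connected. -/

variable {V : Type*} {W : Type*}

/-- Two faces are adjacent when they share an edge. -/
def FaceAdj [DecidableEq V] (faces : Finset (Finset V)) (A B : Finset V) : Prop :=
  A ∈ faces ∧ B ∈ faces ∧ (A ∩ B).card = 2

/-- Two faces at a vertex `v` are adjacent when they share an edge through `v`. -/
def LinkAdj [DecidableEq V] (faces : Finset (Finset V)) (v : V) (A B : Finset V) : Prop :=
  A ∈ faces ∧ B ∈ faces ∧ v ∈ A ∩ B ∧ (A ∩ B).card = 2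

/-- `faces` is the set of faces of a triangulation of a closed surface. -/
structure IsTriangulation [DecidableEq V] (faces : Finset (Finset V)) : Prop where
  nonempty : faces.Nonempty
  card_three : ∀ F ∈ faces, F.card = 3
  edge_two_faces : ∀ e : Finset V, e.card = 2 → (∃ F ∈ faces, e ⊆ F) →
    (faces.filter fun F => e ⊆ F).card = 2
  link_connected : ∀ v : V, ∀ F ∈ faces, ∀ G ∈ faces, v ∈ F → v ∈ G →
    Relation.ReflTransGen (LinkAdj faces v) F G
  connected : ∀ F ∈ faces, ∀ G ∈ faces, Relation.ReflTransGen (FaceAdj faces) F G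

/-- The vertices of a triangulation. -/
def vertexSet [DecidableEq V] (faces : Finset (Finset V)) : Finset V :=
  faces.biUnion id

/-- The edges of a triangulation: the 2-element subsets of faces. -/
noncomputable def edgeSet [DecidableEq V] (faces : Finset (Finset V)) : Finset (Finset V) :=
  ((vertexSet faces).powersetCard 2).filter fun e => ∃ F ∈ faces, e ⊆ F

/-- Euler characteristic `n - e + f`. -/
noncomputable def eulerChar [DecidableEq V] (faces : Finset (Finset V)) : ℤ :=
  ((vertexSet faces).card : ℤ) - ((edgeSet faces).card : ℤ) + (faces.card : ℤ)

/-- Euler genus `2 - χ`. -/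
noncomputable def eulerGenus [DecidableEq V] (faces : Finset (Finset V)) : ℤ :=
  2 - eulerChar faces

/-- The degree of a vertex. -/
noncomputable def degree [DecidableEq V] (faces : Finset (Finset V)) (v : V) : ℕ :=
  ((edgeSet faces).filter fun e => v ∈ e).card

/-- Adjacency of vertices in a triangulation. -/
def Adj [DecidableEq V] (faces : Finset (Finset V)) (a b : V) : Prop :=
  a ≠ b ∧ ∃ F ∈ faces, ({a, b} : Finset V) ⊆ F

/-- A 3-cycle of the graph of the triangulation: three pairwise adjacent vertices. -/
noncomputable def IsTriCycle [DecidableEq V] (faces : Finset (Finset V)) (C : Finset V) : Prop :=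
  C.card = 3 ∧ ∀ e ∈ C.powersetCard 2, e ∈ edgeSet faces

/-- A nonfacial 3-cycle: a 3-cycle which does not bound a face. -/
noncomputable def IsNonfacialTriCycle [DecidableEq V] (faces : Finset (Finset V))
    (C : Finset V) : Prop :=
  IsTriCycle faces C ∧ C ∉ faces

/-- The number of 3-cycles containing a given edge (= common neighbours of its ends). -/
noncomputable def numTriCyclesOn [DecidableEq V] (faces : Finset (Finset V))
    (e : Finset V) : ℕ :=
  ((vertexSet faces).filter fun x => x ∉ e ∧ ∀ y ∈ e, Adj faces x y).card

/-- Contraction of the edge `ac` (the vertex `c` is identified with `a`,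
the two faces containing `ac` collapse, multiple edges/faces merge). -/
def contract [DecidableEq V] (faces : Finset (Finset V)) (a c : V) : Finset (Finset V) :=
  (faces.filter fun F => ¬ (a ∈ F ∧ c ∈ F)).image
    (Finset.image fun x => if x = c then a else x)

/-- A coherent cyclic orientation of one triangular face, given as the set of its three
directed edges. -/
def IsCyclicOrientation [DecidableEq V] (F : Finset V) (d : Finset (V × V)) : Prop :=
  d.card = 3 ∧ (∀ p ∈ d, p.1 ∈ F ∧ p.2 ∈ F ∧ p.1 ≠ p.2) ∧
  (∀ x ∈ F, (d.filter fun p => p.1 = x).card = 1 ∧ (d.filter fun p => p.2 = x).card = 1)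

/-- Orientability: the faces can be coherently oriented (each directed edge is used
by at most one oriented face). -/
def Orientable [DecidableEq V] (faces : Finset (Finset V)) : Prop :=
  ∃ or : Finset V → Finset (V × V),
    (∀ F ∈ faces, IsCyclicOrientation F (or F)) ∧
    (∀ F ∈ faces, ∀ G ∈ faces, F ≠ G → ∀ p ∈ or F, p ∉ or G)

/-- Two (connected, closed) triangulated surfaces are the same surface iff they have the
same Euler characteristic and the same orientability. -/
noncomputable def SameSurface [DecidableEq V] (f₁ f₂ : Finset (Finset V)) : Prop :=
  eulerChar f₁ = eulerChar f₂ ∧ (Orientable f₁ ↔ Orientable f₂)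

/-- The edge `ac` is contractible: contracting it yields again a triangulation
of the same surface. -/
noncomputable def Contractible [DecidableEq V] (faces : Finset (Finset V)) (a c : V) : Prop :=
  ({a, c} : Finset V) ∈ edgeSet faces ∧ IsTriangulation (contract faces a c) ∧
    SameSurface (contract faces a c) faces

/-- An edge (as a 2-element set) is contractible. -/
noncomputable def ContractibleEdge [DecidableEq V] (faces : Finset (Finset V))
    (e : Finset V) : Prop :=
  ∃ a c : V, e = ({a, c} : Finset V) ∧ Contractible faces a c

/-- An irreducible triangulation: no edge is contractible. -/
noncomputable def IrreducibleTri [DecidableEq V] (faces : Finset (Finset V)) : Prop :=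
  IsTriangulation faces ∧ ∀ e ∈ edgeSet faces, ¬ ContractibleEdge faces e

/-- Face adjacency avoiding the edges of the cycle with vertex set `C`. -/
def SeparatesRel [DecidableEq V] (faces : Finset (Finset V)) (C : Finset V)
    (A B : Finset V) : Prop :=
  A ∈ faces ∧ B ∈ faces ∧ (A ∩ B).card = 2 ∧ ¬ (A ∩ B ⊆ C)

/-- A cycle with vertex set `C` is nonseparating iff the complement of the embedded
curve is connected, i.e. any two faces are joined by a path of faces never crossing
an edge of the cycle. -/
def Nonseparating [DecidableEq V] (faces : Finset (Finset V)) (C : Finset V) : Prop :=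
  ∀ A ∈ faces, ∀ B ∈ faces, Relation.ReflTransGen (SeparatesRel faces C) A B

/-- A corner of the cycle `C`: a vertex of `C` together with a face containing it. -/
def Corner [DecidableEq V] (faces : Finset (Finset V)) (C : Finset V)
    (p : V × Finset V) : Prop :=
  p.1 ∈ C ∧ p.2 ∈ faces ∧ p.1 ∈ p.2

/-- Adjacency of corners of `C`: move inside a link avoiding the cycle, or move along
a face containing an edge of the cycle.  The connected components of this relation
are the boundary curves of a regular neighbourhood of the cycle. -/
def CornerRel [DecidableEq V] (faces : Finset (Finset V)) (C : Finset V)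
    (p q : V × Finset V) : Prop :=
  Corner faces C p ∧ Corner faces C q ∧
    ((p.1 = q.1 ∧ (p.2 ∩ q.2).card = 2 ∧ p.1 ∈ p.2 ∩ q.2 ∧ ¬ (p.2 ∩ q.2 ⊆ C)) ∨
     (p.2 = q.2 ∧ p.1 ≠ q.1))

/-- A cycle is one-sided iff a regular neighbourhood of it is a Möbius band, i.e. the
neighbourhood has a single boundary curve: all corners are connected. -/
def OneSided [DecidableEq V] (faces : Finset (Finset V)) (C : Finset V) : Prop :=
  ∀ p q, Corner faces C p → Corner faces C q →
    Relation.ReflTransGen (CornerRel faces C) p q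

/-- `ℓ` enumerates the link of `a` cyclically: the faces at `a` are exactly the
triangles `a ℓᵢ ℓᵢ₊₁`. -/
def IsLink [DecidableEq V] (faces : Finset (Finset V)) (a : V) (d : ℕ)
    (ℓ : ZMod d → V) : Prop :=
  Function.Injective ℓ ∧ (∀ i, ℓ i ≠ a) ∧
    ∀ F : Finset V, (F ∈ faces ∧ a ∈ F) ↔ ∃ i : ZMod d, F = {a, ℓ i, ℓ (i + 1)}

/-- Splitting the vertex `a` along `ℓ₀ a ℓₛ₋₁` (paper's `v₁ a vₛ`): the vertex `a`
becomes the two vertices `a₁ = Sum.inl a` and `a₂ = Sum.inr ()`. -/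
noncomputable def splitFaces [DecidableEq V] (faces : Finset (Finset V)) (a : V) {d : ℕ}
    (ℓ : ZMod d → V) (s : ℕ) : Finset (Finset (V ⊕ Unit)) :=
  ((faces.filter fun F => a ∉ F).image (Finset.image Sum.inl)) ∪
  ((Finset.range (s - 1)).image fun i =>
    ({Sum.inl a, Sum.inl (ℓ (i : ZMod d)), Sum.inl (ℓ ((i : ZMod d) + 1))} :
      Finset (V ⊕ Unit))) ∪
  ((Finset.Ico (s - 1) d).image fun i =>
    ({Sum.inr (), Sum.inl (ℓ (i : ZMod d)), Sum.inl (ℓ ((i : ZMod d) + 1))} :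
      Finset (V ⊕ Unit))) ∪
  {({Sum.inl a, Sum.inr (), Sum.inl (ℓ (0 : ZMod d))} : Finset (V ⊕ Unit)),
   ({Sum.inl a, Sum.inr (), Sum.inl (ℓ ((s - 1 : ℕ) : ZMod d))} : Finset (V ⊕ Unit))}

/-- Renaming of vertices when cutting along a two-sided 3-cycle `w₀w₁w₂`:
faces with `side = true` keep the original vertices, faces with `side = false`
get the new copies `Sum.inr i`. -/
noncomputable def renameTwoSided [DecidableEq V] (w : Fin 3 → V) (s : Bool) (x : V) : V ⊕ Fin 3 :=
  if x = w 0 then (if s then Sum.inl x else Sum.inr 0)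
  else if x = w 1 then (if s then Sum.inl x else Sum.inr 1)
  else if x = w 2 then (if s then Sum.inl x else Sum.inr 2)
  else Sum.inl x

/-- A coherent side assignment for cutting along the two-sided 3-cycle with vertex
set `C`: constant along link arcs avoiding the cycle, and the two faces on an edge
of the cycle lie on opposite sides. -/
def CoherentSide [DecidableEq V] (faces : Finset (Finset V)) (C : Finset V)
    (side : Finset V → Bool) : Prop :=
  (∀ F ∈ faces, ∀ G ∈ faces, (F ∩ G).card = 2 → ((F ∩ G) ∩ C).Nonempty →
      ¬ (F ∩ G ⊆ C) → side F = side G) ∧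
  (∀ F ∈ faces, ∀ G ∈ faces, F ≠ G → (F ∩ G).card = 2 → F ∩ G ⊆ C → side F ≠ side G)

/-- Cut along a two-sided 3-cycle and cap the two resulting boundary 3-cycles
with two new triangular faces. -/
noncomputable def cutCapTwoSided [DecidableEq V] (faces : Finset (Finset V)) (w : Fin 3 → V)
    (side : Finset V → Bool) : Finset (Finset (V ⊕ Fin 3)) :=
  (faces.image fun F => F.image (renameTwoSided w (side F))) ∪
  {({Sum.inl (w 0), Sum.inl (w 1), Sum.inl (w 2)} : Finset (V ⊕ Fin 3)),
   ({Sum.inr 0, Sum.inr 1, Sum.inr 2} : Finset (V ⊕ Fin 3))}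

/-- The six edges of the boundary hexagon `u₁u₂u₃v₁v₂v₃` produced by cutting along a
one-sided 3-cycle; `(i, true)` is `uᵢ₊₁` and `(i, false)` is `vᵢ₊₁`. -/
def hexEdges : Finset (Finset (Fin 3 × Bool)) :=
  { ({(0, true), (1, true)} : Finset (Fin 3 × Bool)),
    ({(1, true), (2, true)} : Finset (Fin 3 × Bool)),
    ({(2, true), (0, false)} : Finset (Fin 3 × Bool)),
    ({(0, false), (1, false)} : Finset (Fin 3 × Bool)),
    ({(1, false), (2, false)} : Finset (Fin 3 × Bool)),
    ({(2, false), (0, true)} : Finset (Fin 3 × Bool)) }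

/-- Renaming of vertices when cutting along a one-sided 3-cycle: the vertex `w i` of a
face becomes the copy `(i, σ i)` on the boundary hexagon. -/
noncomputable def renameOneSided [DecidableEq V] (w : Fin 3 → V) (σ : Fin 3 → Bool) (x : V) :
    V ⊕ (Fin 3 × Bool) ⊕ Unit :=
  if x = w 0 then Sum.inr (Sum.inl (0, σ 0))
  else if x = w 1 then Sum.inr (Sum.inl (1, σ 1))
  else if x = w 2 then Sum.inr (Sum.inl (2, σ 2))
  else Sum.inl x

/-- Coherence of the corner assignment `σ` for cutting along a one-sided 3-cycle
`w₀w₁w₂`: constant along link arcs avoiding the cycle, each face on an edge of the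
cycle produces an edge of the boundary hexagon, and each hexagon edge is produced by
exactly one face. -/
noncomputable def CoherentOneSided [DecidableEq V] (faces : Finset (Finset V)) (w : Fin 3 → V)
    (σ : Finset V → Fin 3 → Bool) : Prop :=
  (∀ F ∈ faces, ∀ G ∈ faces, ∀ i : Fin 3, (F ∩ G).card = 2 → w i ∈ F ∩ G →
      ¬ (F ∩ G ⊆ ({w 0, w 1, w 2} : Finset V)) → σ F i = σ G i) ∧
  (∀ F ∈ faces, ∀ i j : Fin 3, i ≠ j → ({w i, w j} : Finset V) ⊆ F →
      ({(i, σ F i), (j, σ F j)} : Finset (Fin 3 × Bool)) ∈ hexEdges) ∧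
  (∀ h ∈ hexEdges,
    (faces.filter fun F => ∃ i j : Fin 3, i ≠ j ∧ ({w i, w j} : Finset V) ⊆ F ∧
      ({(i, σ F i), (j, σ F j)} : Finset (Fin 3 × Bool)) = h).card = 1)

/-- Cut along a one-sided 3-cycle and cap the resulting boundary hexagon with a new
vertex `t' = Sum.inr (Sum.inr ())` joined to the six boundary vertices. -/
noncomputable def cutCapOneSided [DecidableEq V] (faces : Finset (Finset V)) (w : Fin 3 → V)
    (σ : Finset V → Fin 3 → Bool) : Finset (Finset (V ⊕ (Fin 3 × Bool) ⊕ Unit)) :=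
  (faces.image fun F => F.image (renameOneSided w (σ F))) ∪
  (hexEdges.image fun h =>
    insert (Sum.inr (Sum.inr ()))
      (h.image fun p => (Sum.inr (Sum.inl p) : V ⊕ (Fin 3 × Bool) ⊕ Unit)))

/-- Adding a handle: remove the faces `abc` and `def` and identify `d ↦ a`, `e ↦ b`,
`f ↦ c`. -/
noncomputable def glueHandle [DecidableEq V] (faces : Finset (Finset V)) (a b c d e f : V) :
    Finset (Finset V) :=
  ((faces \ {({a, b, c} : Finset V), ({d, e, f} : Finset V)}).image
    (Finset.image fun x => if x = d then a else if x = e then b else if x = f then c else x))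

/-- Adding a crosscap at a degree six vertex `t` with link `ℓ₀ … ℓ₅`: remove `t` with
its incident edges and faces and identify opposite vertices of the hexagonal hole. -/
noncomputable def addCrosscap [DecidableEq V] (faces : Finset (Finset V)) (t : V) (ℓ : ZMod 6 → V) :
    Finset (Finset V) :=
  (faces.filter fun F => t ∉ F).image
    (Finset.image fun x =>
      if x = ℓ 3 then ℓ 0 else if x = ℓ 4 then ℓ 1 else if x = ℓ 5 then ℓ 2 else x)

/-- Connected sum of two triangulations along the faces `abc` and `def`. -/
noncomputable def glueSum [DecidableEq V] [DecidableEq W] (f₁ : Finset (Finset V))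
    (f₂ : Finset (Finset W)) (a b c : V) (d e f : W) : Finset (Finset (V ⊕ W)) :=
  ((f₁.erase {a, b, c}).image (Finset.image Sum.inl)) ∪
  ((f₂.erase {d, e, f}).image (Finset.image fun y =>
    if y = d then Sum.inl a else if y = e then Sum.inl b
    else if y = f then Sum.inl c else (Sum.inr y : V ⊕ W)))

section Helpers

variable {V : Type*} [DecidableEq V]

/-- The vertex identification used by `contract`. -/
def phi (a c : V) (x : V) : V := if x = c then a else x

lemma mem_contract (faces : Finset (Finset V)) (a c : V) (G : Finset V) :
    G ∈ contract faces a c ↔ ∃ F ∈ faces, ¬ (a ∈ F ∧ c ∈ F) ∧ F.image (phi a c) = G := by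
  unfold contract
  constructor
  · intro h
    obtain ⟨F, hF, rfl⟩ := Finset.mem_image.1 h
    rw [Finset.mem_filter] at hF
    exact ⟨F, hF.1, hF.2, rfl⟩
  · rintro ⟨F, h1, h2, rfl⟩
    exact Finset.mem_image.2 ⟨F, Finset.mem_filter.2 ⟨h1, h2⟩, rfl⟩

lemma mem_phi {a c : V} (_hac : a ≠ c) (F : Finset V) (x : V) :
    x ∈ F.image (phi a c) ↔ (x ≠ c ∧ x ∈ F) ∨ (x = a ∧ c ∈ F) := by
  simp only [Finset.mem_image, phi]
  constructor
  · rintro ⟨y, hy, h⟩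
    split_ifs at h <;> grind
  · rintro (⟨h1, h2⟩ | ⟨h1, h2⟩)
    · exact ⟨x, h2, by simp [h1]⟩
    · exact ⟨c, h2, by simp [h1]⟩

lemma phi_card {a c : V} (F : Finset V) (h : ¬ (a ∈ F ∧ c ∈ F)) :
    (F.image (phi a c)).card = F.card := by
  apply Finset.card_image_of_injOn
  intro x hx y hy hxy
  simp only [phi] at hxy
  have hx' : x ∈ F := hx
  have hy' : y ∈ F := hy
  split_ifs at hxy <;> grind

lemma phi_fix {a c : V} (F : Finset V) (h : c ∉ F) : F.image (phi a c) = F := by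
  ext x
  simp only [Finset.mem_image, phi]
  constructor
  · rintro ⟨y, hy, h⟩
    split_ifs at h <;> grind
  · intro hx
    exact ⟨x, hx, by grind⟩

lemma eq_triple {F : Finset V} (h : F.card = 3) {x y z : V} (hx : x ∈ F) (hy : y ∈ F)
    (hz : z ∈ F) (hxy : x ≠ y) (hxz : x ≠ z) (hyz : y ≠ z) : F = {x, y, z} := by
  symm
  apply Finset.eq_of_subset_of_card_le
  · intro t ht
    simp at ht
    grind
  · rw [h, Finset.card_eq_three.2 ⟨x, y, z, hxy, hxz, hyz, rfl⟩]

lemma exists_third {F : Finset V} (h : F.card = 3) {x y : V} (hx : x ∈ F) (hy : y ∈ F)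
    (hxy : x ≠ y) : ∃ z, z ≠ x ∧ z ≠ y ∧ F = {x, y, z} := by
  obtain ⟨z, hz, hz2⟩ : ∃ z ∈ F, z ∉ ({x, y} : Finset V) := by
    by_contra hcon
    push Not at hcon
    have := Finset.card_le_card (show F ⊆ {x, y} from hcon)
    have := Finset.card_le_two (a := x) (b := y)
    omega
  simp at hz2
  exact ⟨z, hz2.1, hz2.2, eq_triple h hx hy hz hxy (Ne.symm hz2.1) (Ne.symm hz2.2)⟩

lemma inter_card_two {A B : Finset V} (hA : A.card = 3) (hB : B.card = 3) {x y : V}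
    (hxy : x ≠ y) (hx : x ∈ A) (hx' : x ∈ B) (hy : y ∈ A) (hy' : y ∈ B) (hne : A ≠ B) :
    (A ∩ B).card = 2 := by
  have h1 : 2 ≤ (A ∩ B).card := by
    have : ({x, y} : Finset V) ⊆ A ∩ B := by
      intro t ht; simp at ht; grind
    have h2 := Finset.card_le_card this
    rwa [Finset.card_pair hxy] at h2
  have h3 : (A ∩ B).card ≤ 3 := by
    rw [← hA]; exact Finset.card_le_card Finset.inter_subset_left
  have h4 : (A ∩ B).card ≠ 3 := by
    intro h
    have e1 : A ∩ B = A := Finset.eq_of_subset_of_card_le Finset.inter_subset_left (by omega)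
    have e2 : A ∩ B = B := Finset.eq_of_subset_of_card_le Finset.inter_subset_right (by omega)
    exact hne (e1.symm.trans e2)
  omega

lemma other_face {faces : Finset (Finset V)} (T : IsTriangulation faces) {F : Finset V}
    (hF : F ∈ faces) {x y : V} (hxy : x ≠ y) (hx : x ∈ F) (hy : y ∈ F) :
    ∃ G ∈ faces, G ≠ F ∧ x ∈ G ∧ y ∈ G ∧ ∀ H ∈ faces, x ∈ H → y ∈ H → H = F ∨ H = G := by
  have h2 := T.edge_two_faces {x, y} (Finset.card_pair hxy)
    ⟨F, hF, by intro t ht; simp at ht; grind⟩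
  have key : ∀ H, H ∈ faces.filter (fun F => ({x, y} : Finset V) ⊆ F) ↔
      H ∈ faces ∧ x ∈ H ∧ y ∈ H := by
    intro H
    rw [Finset.mem_filter]
    simp [Finset.insert_subset_iff]
  obtain ⟨A, B, hAB, hE⟩ := Finset.card_eq_two.1 h2
  rw [hE] at key
  have hF' := (key F).2 ⟨hF, hx, hy⟩
  have hA := (key A).1 (by simp)
  have hB := (key B).1 (by simp)
  simp only [Finset.mem_insert, Finset.mem_singleton] at key hF'
  rcases hF' with rfl | rfl
  · exact ⟨B, hB.1, hAB.symm, hB.2.1, hB.2.2, fun H h1 h2 h3 => (key H).2 ⟨h1, h2, h3⟩⟩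
  · exact ⟨A, hA.1, hAB, hA.2.1, hA.2.2, fun H h1 h2 h3 => ((key H).2 ⟨h1, h2, h3⟩).symm⟩

/-- Converse of `other_face`: recognising two faces on an edge. -/
lemma two_faces_of {faces : Finset (Finset V)} {e : Finset V} {A B : Finset V}
    (hA : A ∈ faces) (hB : B ∈ faces) (hAB : A ≠ B) (hxA : e ⊆ A)
    (hxB : e ⊆ B) (h : ∀ H ∈ faces, e ⊆ H → H = A ∨ H = B) :
    (faces.filter fun F => e ⊆ F).card = 2 := by
  rw [Finset.card_eq_two]
  refine ⟨A, B, hAB, ?_⟩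
  ext H
  simp only [Finset.mem_filter, Finset.mem_insert, Finset.mem_singleton]
  constructor
  · rintro ⟨h1, h2⟩; exact h H h1 h2
  · rintro (rfl | rfl)
    · exact ⟨hA, hxA⟩
    · exact ⟨hB, hxB⟩

/-- The situation of an edge `ac` all of whose 3-cycles are facial. -/
structure Ctx (faces : Finset (Finset V)) (a c b e : V) (n : ℕ) (p : ℕ → V) : Prop where
  T : IsTriangulation faces
  hac : a ≠ c
  hab : a ≠ b
  hae : a ≠ e
  hcb : c ≠ b
  hce : c ≠ e
  hbe : b ≠ e
  fb : {a, c, b} ∈ faces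
  fe : {a, c, e} ∈ faces
  common : ∀ x, ∀ F ∈ faces, ∀ G ∈ faces, a ∈ F → x ∈ F → c ∈ G → x ∈ G →
    x ≠ a → x ≠ c → x = b ∨ x = e
  notK4 : ¬ (({a, b, e} : Finset V) ∈ faces ∧ ({c, b, e} : Finset V) ∈ faces)
  hn : 1 ≤ n
  p0 : p 0 = b
  pn : p n = e
  pc : ∀ i ≤ n, p i ≠ c
  pf : ∀ i < n, ({a, p i, p (i + 1)} : Finset V) ∈ faces
  pne : ∀ i, i + 1 < n → ({a, p i, p (i + 1)} : Finset V) ≠ {a, p (i + 1), p (i + 1 + 1)}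

namespace Ctx

variable {faces : Finset (Finset V)} {a c b e : V} {n : ℕ} {p : ℕ → V}

lemma ac_face (X : Ctx faces a c b e n p) {F : Finset V} (hF : F ∈ faces) (ha : a ∈ F)
    (hc : c ∈ F) : F = {a, c, b} ∨ F = {a, c, e} := by
  obtain ⟨G, hG, hne, _, _, h⟩ := other_face X.T X.fb X.hac (by simp) (by simp)
  have hne2 : ({a, c, e} : Finset V) ≠ {a, c, b} := by
    intro h
    have : e ∈ ({a, c, b} : Finset V) := by rw [← h]; simp
    simp at this
    have h1 := X.hae; have h2 := X.hce; have h3 := X.hbe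
    grind
  have h1 := h _ X.fe (by simp) (by simp)
  have h2 := h F hF ha hc
  grind

lemma phi_inj (X : Ctx faces a c b e n p) {F G : Finset V} (hF : F ∈ faces) (hG : G ∈ faces)
    (hFr : ¬ (a ∈ F ∧ c ∈ F)) (hGr : ¬ (a ∈ G ∧ c ∈ G))
    (h : F.image (phi a c) = G.image (phi a c)) : F = G := by
  have hmem : ∀ x, ((x ≠ c ∧ x ∈ F) ∨ (x = a ∧ c ∈ F)) ↔ ((x ≠ c ∧ x ∈ G) ∨ (x = a ∧ c ∈ G)) := by
    intro x
    rw [← mem_phi X.hac, ← mem_phi X.hac, h]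
  have key : ∀ F G : Finset V, F ∈ faces → G ∈ faces → ¬ (a ∈ F ∧ c ∈ F) →
      (∀ x, ((x ≠ c ∧ x ∈ F) ∨ (x = a ∧ c ∈ F)) ↔ ((x ≠ c ∧ x ∈ G) ∨ (x = a ∧ c ∈ G))) →
      c ∈ F → c ∉ G → False := by
    intro F G hF hG hFr hmem hcF hcG
    have haF : a ∉ F := fun h => hFr ⟨h, hcF⟩
    have haG : a ∈ G := by have := hmem a; grind
    have hFx : ∀ x ∈ F, x ≠ c → x = b ∨ x = e := by
      intro x hx hxc
      have hxG : x ∈ G := by have := hmem x; grind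
      exact X.common x G hG F hF haG hxG hcF hx (by rintro rfl; exact haF hx) hxc
    have hFs : F = {c, b, e} := by
      apply Finset.eq_of_subset_of_card_le
      · intro x hx
        have := hFx x hx
        simp; tauto
      · rw [X.T.card_three F hF]; exact Finset.card_le_three
    have hb : b ∈ G := by
      have h1 := (hmem b).1 (Or.inl ⟨X.hcb.symm, by rw [hFs]; simp⟩)
      have h2 := X.hab
      grind
    have he : e ∈ G := by
      have h1 := (hmem e).1 (Or.inl ⟨X.hce.symm, by rw [hFs]; simp⟩)
      have h2 := X.hae
      grind
    have hGs := eq_triple (X.T.card_three G hG) haG hb he X.hab X.hae X.hbe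
    exact X.notK4 ⟨hGs ▸ hG, hFs ▸ hF⟩
  by_cases hcF : c ∈ F <;> by_cases hcG : c ∈ G
  · ext x
    have := hmem x
    grind
  · exact (key F G hF hG hFr hmem hcF hcG).elim
  · exact (key G F hG hF hGr (fun x => (hmem x).symm) hcG hcF).elim
  · rwa [phi_fix F hcF, phi_fix G hcG] at h

lemma c_ne_path (X : Ctx faces a c b e n p) {i : ℕ} (hi : i < n) :
    c ∉ ({a, p i, p (i + 1)} : Finset V) := by
  have h1 := X.hac; have h2 := X.pc i (by omega); have h3 := X.pc (i+1) (by omega)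
  simp; grind

lemma path_mem (X : Ctx faces a c b e n p) {i : ℕ} (hi : i < n) :
    ({a, p i, p (i + 1)} : Finset V) ∈ contract faces a c := by
  rw [mem_contract]
  exact ⟨_, X.pf i hi, fun h => X.c_ne_path hi h.2, phi_fix _ (X.c_ne_path hi)⟩

/-- The replacement face in the contraction for every face. -/
lemma exists_psi (X : Ctx faces a c b e n p) : ∃ psi : Finset V → Finset V,
    (∀ F ∈ faces, psi F ∈ contract faces a c) ∧
    (∀ F ∈ faces, F.image (phi a c) ⊆ psi F) ∧
    (∀ F ∈ faces, ¬ (a ∈ F ∧ c ∈ F) → psi F = F.image (phi a c)) ∧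
    psi {a, c, b} = {a, p 0, p (0 + 1)} ∧ psi {a, c, e} = {a, p (n - 1), p (n - 1 + 1)} := by
  have hn := X.hn
  have hpn : p (n - 1 + 1) = e := by rw [Nat.sub_add_cancel hn, X.pn]
  have hne : ({a, c, e} : Finset V) ≠ {a, c, b} := by
    intro h
    have : e ∈ ({a, c, b} : Finset V) := by rw [← h]; simp
    simp at this
    have h1 := X.hae; have h2 := X.hce; have h3 := X.hbe
    grind
  refine ⟨fun F => if F = {a, c, b} then {a, p 0, p (0 + 1)} else if F = {a, c, e} then
    {a, p (n - 1), p (n - 1 + 1)} else F.image (phi a c), ?_, ?_, ?_, ?_, ?_⟩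
  · intro F hF
    dsimp only
    split_ifs with h1 h2
    · exact X.path_mem (by omega)
    · exact X.path_mem (by omega)
    · rw [mem_contract]
      refine ⟨F, hF, ?_, rfl⟩
      rintro ⟨ha, hc⟩
      have := X.ac_face hF ha hc
      tauto
  · intro F hF x hx
    rw [mem_phi X.hac] at hx
    dsimp only
    split_ifs with h1 h2
    · subst h1; have := X.p0; simp at hx ⊢; grind
    · subst h2; simp at hx ⊢; grind
    · rw [mem_phi X.hac]; exact hx
  · intro F hF h
    have h1 : F ≠ {a, c, b} := by rintro rfl; simp at h
    have h2 : F ≠ {a, c, e} := by rintro rfl; simp at h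
    simp [h1, h2]
  · simp
  · simp [hne]

lemma card_three' (X : Ctx faces a c b e n p) : ∀ F ∈ contract faces a c, F.card = 3 := by
  intro F hF
  rw [mem_contract] at hF
  obtain ⟨G, hG, h1, rfl⟩ := hF
  rw [phi_card G h1, X.T.card_three G hG]

lemma path_adj (X : Ctx faces a c b e n p) (i : ℕ) (hi : i < n) :
    Relation.ReflTransGen (LinkAdj (contract faces a c) a)
      {a, p 0, p (0 + 1)} {a, p i, p (i + 1)} := by
  induction i with
  | zero => exact .refl
  | succ i ih =>
    refine (ih (by omega)).tail ⟨X.path_mem (by omega), X.path_mem hi, by simp, ?_⟩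
    have hap : a ≠ p (i + 1) := by
      intro h
      have h3 := X.T.card_three _ (X.pf i (by omega))
      rw [← h] at h3
      have : ({a, p i, a} : Finset V) = {a, p i} := by ext; simp; tauto
      rw [this] at h3
      have := Finset.card_le_two (a := a) (b := p i)
      omega
    exact inter_card_two (X.T.card_three _ (X.pf i (by omega))) (X.T.card_three _ (X.pf _ hi))
      hap (by simp) (by simp) (by simp) (by simp) (X.pne i hi)

lemma LinkAdj_symm (S : Finset (Finset V)) (v : V) : Std.Symm (LinkAdj S v) :=
  ⟨fun A B ⟨h1, h2, h3, h4⟩ => ⟨h2, h1, by rwa [Finset.inter_comm], by rwa [Finset.inter_comm]⟩⟩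

lemma rtg_symm {S : Finset (Finset V)} {v : V} {A B : Finset V}
    (h : Relation.ReflTransGen (LinkAdj S v) A B) : Relation.ReflTransGen (LinkAdj S v) B A := by
  have := LinkAdj_symm S v
  exact Relation.ReflTransGen.stdSymm.symm _ _ h

lemma edge_two' (X : Ctx faces a c b e n p) : ∀ s : Finset V, s.card = 2 →
    (∃ F ∈ contract faces a c, s ⊆ F) →
    ((contract faces a c).filter fun F => s ⊆ F).card = 2 := by
  intro s hs ⟨F', hF', hsF⟩
  obtain ⟨F, hF, hFr, rfl⟩ := (mem_contract _ _ _ _).1 hF'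
  have hac := X.hac
  obtain ⟨x, y, hxy, rfl⟩ := Finset.card_eq_two.1 hs
  have sub : ∀ (x y : V) (G : Finset V), ({x, y} : Finset V) ⊆ G ↔ x ∈ G ∧ y ∈ G := by
    intro x y G; simp [Finset.insert_subset_iff]
  rw [sub] at hsF
  have hmk : ∀ G ∈ faces, ¬ (a ∈ G ∧ c ∈ G) → G.image (phi a c) ∈ contract faces a c :=
    fun G h1 h2 => (mem_contract _ _ _ _).2 ⟨G, h1, h2, rfl⟩
  -- the edges through `a`
  have main : ∀ x, x ≠ a → (x ∈ F.image (phi a c)) → (a ∈ F.image (phi a c)) →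
      ((contract faces a c).filter fun F => ({a, x} : Finset V) ⊆ F).card = 2 := by
    intro x hxa hxF haF
    have hxc : x ≠ c := by
      rintro rfl; rw [mem_phi hac] at hxF; grind
    have cond : ∀ G : Finset V, ({a, x} : Finset V) ⊆ G.image (phi a c) ↔ (a ∈ G ∨ c ∈ G) ∧ x ∈ G := by
      intro G
      rw [sub, mem_phi hac, mem_phi hac]
      grind
    have hF2 := (cond F).1 ((sub _ _ _).2 ⟨haF, hxF⟩)
    by_cases hT : ({a, c, x} : Finset V) ∈ faces
    · -- one face on each side
      obtain ⟨A, hA, hAne, haA, hxA, hAall⟩ :=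
        other_face X.T hT (x := a) (y := x) hxa.symm (by simp) (by simp)
      obtain ⟨B, hB, hBne, hcB, hxB, hBall⟩ :=
        other_face X.T hT (x := c) (y := x) hxc.symm (by simp) (by simp)
      have hcA : c ∉ A := fun h => hAne
        (eq_triple (X.T.card_three A hA) haA h hxA hac hxa.symm hxc.symm)
      have haB : a ∉ B := fun h => hBne
        (eq_triple (X.T.card_three B hB) h hcB hxB hac hxa.symm hxc.symm)
      apply two_faces_of (hmk A hA (by tauto)) (hmk B hB (by tauto))
      · intro h
        have := X.phi_inj hA hB (by tauto) (by tauto) h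
        subst this; exact hcA hcB
      · rw [cond]; tauto
      · rw [cond]; tauto
      · intro H' hH' hsub
        obtain ⟨H, hH, hHr, rfl⟩ := (mem_contract _ _ _ _).1 hH'
        rw [cond] at hsub
        rcases hsub with ⟨h1 | h1, h2⟩
        · rcases hAall H hH h1 h2 with rfl | rfl
          · simp at hHr
          · left; rfl
        · rcases hBall H hH h1 h2 with rfl | rfl
          · simp at hHr
          · right; rfl
    · have hnb : x ≠ b := by rintro rfl; exact hT X.fb
      have hne : x ≠ e := by rintro rfl; exact hT X.fe
      have key : ∀ u w : V, u ≠ x → (u = a ∧ w = c ∨ u = c ∧ w = a) → u ∈ F →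
          ((contract faces a c).filter fun F => ({a, x} : Finset V) ⊆ F).card = 2 := by
        intro u w hux huw huF
        obtain ⟨A, hA, hAne, haA, hxA, hAall⟩ := other_face X.T hF hux huF hF2.2
        have hw : ∀ H ∈ faces, x ∈ H → w ∉ H := by
          intro H hH hx hwH
          have := X.common x
          rcases huw with ⟨rfl, rfl⟩ | ⟨rfl, rfl⟩
          · exact (this F hF H hH huF hF2.2 hwH hx hxa hxc).elim hnb hne
          · exact (this H hH F hF hwH hx huF hF2.2 hxa hxc).elim hnb hne
        have hr : ∀ H ∈ faces, x ∈ H → ¬ (a ∈ H ∧ c ∈ H) := by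
          intro H hH hx; have := hw H hH hx; grind
        apply two_faces_of (hmk F hF hFr) (hmk A hA (hr A hA hxA))
        · intro h
          exact hAne (X.phi_inj hF hA hFr (hr A hA hxA) h).symm
        · rw [cond]; exact hF2
        · rw [cond]; grind
        · intro H' hH' hsub
          obtain ⟨H, hH, hHr, rfl⟩ := (mem_contract _ _ _ _).1 hH'
          rw [cond] at hsub
          have := hw H hH hsub.2
          rcases hAall H hH (by grind) hsub.2 with rfl | rfl
          · left; rfl
          · right; rfl
      rcases hF2.1 with h | h
      · exact key a c hxa.symm (Or.inl ⟨rfl, rfl⟩) h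
      · exact key c a hxc.symm (Or.inr ⟨rfl, rfl⟩) h
  by_cases hxa : x = a
  · subst hxa
    exact main y hxy.symm hsF.2 hsF.1
  by_cases hya : y = a
  · subst hya
    rw [Finset.pair_comm]
    exact main x hxy hsF.1 hsF.2
  -- edges avoiding `a`
  have hxc : x ≠ c := by
    rintro rfl; rw [mem_phi hac] at hsF; grind
  have hyc : y ≠ c := by
    rintro rfl; rw [mem_phi hac, mem_phi hac] at hsF; grind
  have cond : ∀ G : Finset V, ({x, y} : Finset V) ⊆ G.image (phi a c) ↔ x ∈ G ∧ y ∈ G := by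
    intro G
    rw [sub, mem_phi hac, mem_phi hac]
    grind
  have hF2 := (cond F).1 ((sub _ _ _).2 hsF)
  have hr : ∀ H ∈ faces, x ∈ H → y ∈ H → ¬ (a ∈ H ∧ c ∈ H) := by
    rintro H hH hx hy ⟨ha, hc⟩
    have := eq_triple (X.T.card_three H hH) ha hc hx hac (Ne.symm hxa) hxc.symm
    rw [this] at hy
    simp at hy
    grind
  obtain ⟨A, hA, hAne, hxA, hyA, hAall⟩ := other_face X.T hF hxy hF2.1 hF2.2
  apply two_faces_of (hmk F hF hFr) (hmk A hA (hr A hA hxA hyA))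
  · intro h
    exact hAne (X.phi_inj hF hA hFr (hr A hA hxA hyA) h).symm
  · rw [cond]; exact hF2
  · rw [cond]; exact ⟨hxA, hyA⟩
  · intro H' hH' hsub
    obtain ⟨H, hH, hHr, rfl⟩ := (mem_contract _ _ _ _).1 hH'
    rw [cond] at hsub
    rcases hAall H hH hsub.1 hsub.2 with rfl | rfl
    · left; rfl
    · right; rfl

lemma link_conn' (X : Ctx faces a c b e n p) : ∀ v : V, ∀ F ∈ contract faces a c,
    ∀ G ∈ contract faces a c, v ∈ F → v ∈ G →
    Relation.ReflTransGen (LinkAdj (contract faces a c) v) F G := by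
  obtain ⟨psi, hm, hsub, hR, hpb, hpe⟩ := X.exists_psi
  have hac := X.hac
  have hstep : ∀ v A B, LinkAdj faces v A B →
      Relation.ReflTransGen (LinkAdj (contract faces a c) (phi a c v)) (psi A) (psi B) := by
    rintro v A B ⟨hA, hB, hv, hcard⟩
    obtain ⟨y, hy, hyv⟩ := Finset.exists_mem_ne (by omega : 1 < (A ∩ B).card) v
    rw [Finset.mem_inter] at hv hy
    by_cases hvy : phi a c v = phi a c y
    · -- the edge `ac`
      have hvy2 : (a ∈ A ∧ a ∈ B) ∧ (c ∈ A ∧ c ∈ B) ∧ phi a c v = a := by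
        simp only [phi] at hvy ⊢
        split_ifs at hvy ⊢ <;> grind
      obtain ⟨⟨h1, h2⟩, ⟨h3, h4⟩, h5⟩ := hvy2
      rw [h5]
      have hn := X.hn
      have hp := X.path_adj (n - 1) (by omega)
      rcases X.ac_face hA h1 h3 with rfl | rfl <;> rcases X.ac_face hB h2 h4 with rfl | rfl
      · exact .refl
      · rw [hpb, hpe]; exact hp
      · rw [hpb, hpe]; exact rtg_symm hp
      · exact .refl
    · by_cases hne : psi A = psi B
      · rw [hne]
      · have i1 := hsub A hA (Finset.mem_image_of_mem (phi a c) hv.1)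
        have i2 := hsub B hB (Finset.mem_image_of_mem (phi a c) hv.2)
        have i3 := hsub A hA (Finset.mem_image_of_mem (phi a c) hy.1)
        have i4 := hsub B hB (Finset.mem_image_of_mem (phi a c) hy.2)
        exact .single ⟨hm A hA, hm B hB, Finset.mem_inter.2 ⟨i1, i2⟩,
          inter_card_two (X.card_three' _ (hm A hA)) (X.card_three' _ (hm B hB)) hvy i1 i2 i3 i4 hne⟩
  have hpath : ∀ v A B, A ∈ faces → B ∈ faces → v ∈ A → v ∈ B →
      Relation.ReflTransGen (LinkAdj (contract faces a c) (phi a c v)) (psi A) (psi B) := by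
    intro v A B hA hB h1 h2
    exact Relation.ReflTransGen.lift' psi (hstep v) _ _ (X.T.link_connected v A hA B hB h1 h2)
  have hphia : phi a c a = a := by simp [phi]
  have hphic : phi a c c = a := by simp [phi]
  intro v F' hF' G' hG' hvF hvG
  obtain ⟨F, hF, hFr, rfl⟩ := (mem_contract _ _ _ _).1 hF'
  obtain ⟨G, hG, hGr, rfl⟩ := (mem_contract _ _ _ _).1 hG'
  rw [← hR F hF hFr, ← hR G hG hGr]
  have hvc : v ≠ c := by rintro rfl; rw [mem_phi hac] at hvF; grind
  rw [mem_phi hac] at hvF hvG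
  by_cases hva : v = a
  · subst hva
    have toB : ∀ F ∈ faces, (v ∈ F ∨ c ∈ F) →
        Relation.ReflTransGen (LinkAdj (contract faces v c) v) (psi F) (psi {v, c, b}) := by
      intro F hF h
      rcases h with h | h
      · have := hpath v F {v, c, b} hF X.fb h (by simp)
        rwa [hphia] at this
      · have := hpath c F {v, c, b} hF X.fb h (by simp)
        rwa [hphic] at this
    exact (toB F hF (by tauto)).trans (rtg_symm (toB G hG (by tauto)))
  · have := hpath v F G hF hG (by tauto) (by tauto)
    rwa [show phi a c v = v by simp [phi, hvc]] at this

lemma isTri' (X : Ctx faces a c b e n p) : IsTriangulation (contract faces a c) where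
  nonempty := ⟨_, X.path_mem (i := 0) X.hn⟩
  card_three := X.card_three'
  edge_two_faces := X.edge_two'
  link_connected := X.link_conn'
  connected := by
    obtain ⟨psi, hm, hsub, hR, hpb, hpe⟩ := X.exists_psi
    intro F' hF' G' hG'
    obtain ⟨F, hF, hFr, rfl⟩ := (mem_contract _ _ _ _).1 hF'
    obtain ⟨G, hG, hGr, rfl⟩ := (mem_contract _ _ _ _).1 hG'
    rw [← hR F hF hFr, ← hR G hG hGr]
    refine Relation.ReflTransGen.lift' psi ?_ _ _ (X.T.connected F hF G hG)
    rintro A B ⟨hA, hB, hcard⟩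
    obtain ⟨v, hv⟩ := Finset.card_pos.1 (by omega : 0 < (A ∩ B).card)
    rw [Finset.mem_inter] at hv
    have := X.link_conn' (phi a c v) _ (hm A hA) _ (hm B hB)
      (hsub A hA (Finset.mem_image_of_mem _ hv.1)) (hsub B hB (Finset.mem_image_of_mem _ hv.2))
    have hmono : ∀ A B, LinkAdj (contract faces a c) (phi a c v) A B →
        FaceAdj (contract faces a c) A B := fun _ _ h => ⟨h.1, h.2.1, h.2.2.2⟩
    exact Relation.ReflTransGen.mono hmono _ _ this

end Ctx

lemma three_mul_faces {S : Finset (Finset V)} (T : IsTriangulation S) :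
    S.card * 3 = (edgeSet S).card * 2 := by
  apply Finset.card_mul_eq_card_mul (fun F s => s ⊆ F)
  · intro F hF
    have : (edgeSet S).bipartiteAbove (fun F s => s ⊆ F) F = F.powersetCard 2 := by
      ext s
      simp only [Finset.bipartiteAbove, edgeSet, Finset.mem_filter, Finset.mem_powersetCard]
      constructor
      · rintro ⟨⟨⟨_, h1⟩, _⟩, h2⟩; exact ⟨h2, h1⟩
      · rintro ⟨h1, h2⟩
        refine ⟨⟨⟨?_, h2⟩, F, hF, h1⟩, h1⟩
        intro x hx
        exact Finset.mem_biUnion.2 ⟨F, hF, h1 hx⟩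
    rw [this, Finset.card_powersetCard, T.card_three F hF]
    rfl
  · intro s hs
    simp only [edgeSet, Finset.mem_filter, Finset.mem_powersetCard] at hs
    have := T.edge_two_faces s hs.1.2 hs.2
    convert this using 2
    ext F
    simp [Finset.bipartiteBelow]

namespace Ctx

variable {faces : Finset (Finset V)} {a c b e : V} {n : ℕ} {p : ℕ → V}

lemma euler' (X : Ctx faces a c b e n p) : eulerChar (contract faces a c) = eulerChar faces := by
  have h1 := three_mul_faces X.T
  have h2 := three_mul_faces X.isTri'
  have hne : ({a, c, b} : Finset V) ≠ {a, c, e} := by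
    intro h
    have : e ∈ ({a, c, b} : Finset V) := by rw [h]; simp
    simp at this
    have h1 := X.hae; have h2 := X.hce; have h3 := X.hbe
    grind
  have hf : (contract faces a c).card + 2 = faces.card := by
    have e1 : (contract faces a c).card = (faces.filter fun F => ¬ (a ∈ F ∧ c ∈ F)).card := by
      unfold contract
      apply Finset.card_image_of_injOn
      intro F hF G hG h
      rw [Finset.mem_coe, Finset.mem_filter] at hF hG
      exact X.phi_inj hF.1 hG.1 hF.2 hG.2 h
    have e2 : (faces.filter fun F => (a ∈ F ∧ c ∈ F)).card = 2 := by
      rw [Finset.card_eq_two]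
      refine ⟨_, _, hne, ?_⟩
      ext F
      simp only [Finset.mem_filter, Finset.mem_insert, Finset.mem_singleton]
      constructor
      · rintro ⟨h1, h2, h3⟩; exact X.ac_face h1 h2 h3
      · rintro (rfl | rfl)
        · exact ⟨X.fb, by simp, by simp⟩
        · exact ⟨X.fe, by simp, by simp⟩
    have e3 := Finset.card_filter_add_card_filter_not (s := faces) (fun F => (a ∈ F ∧ c ∈ F))
    omega
  have hv : (vertexSet (contract faces a c)).card + 1 = (vertexSet faces).card := by
    have hc : c ∈ vertexSet faces := Finset.mem_biUnion.2 ⟨_, X.fb, by simp⟩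
    have : vertexSet (contract faces a c) = (vertexSet faces).erase c := by
      obtain ⟨psi, hm, hsub, hR, hpb, hpe⟩ := X.exists_psi
      ext x
      simp only [vertexSet, Finset.mem_erase, Finset.mem_biUnion, id]
      constructor
      · rintro ⟨G, hG, hx⟩
        obtain ⟨F, hF, hFr, rfl⟩ := (mem_contract _ _ _ _).1 hG
        rw [mem_phi X.hac] at hx
        rcases hx with ⟨h1, h2⟩ | ⟨rfl, h2⟩
        · exact ⟨h1, F, hF, h2⟩
        · exact ⟨X.hac, _, X.fb, by simp⟩
      · rintro ⟨h1, F, hF, hx⟩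
        refine ⟨psi F, hm F hF, hsub F hF ?_⟩
        rw [mem_phi X.hac]
        exact Or.inl ⟨h1, hx⟩
    rw [this, Finset.card_erase_add_one hc]
  unfold eulerChar
  omega

end Ctx

/-- The cyclic orientation `x → y → z → x`. -/
def Cyc (x y z : V) : Finset (V × V) := {(x, y), (y, z), (z, x)}

lemma cyc_isCyclic {x y z : V} (hxy : x ≠ y) (hxz : x ≠ z) (hyz : y ≠ z) :
    IsCyclicOrientation {x, y, z} (Cyc x y z) := by
  have e1 : ∀ t, (∃ q, (Cyc x y z).filter (fun p => p.1 = t) = {q}) →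
      ((Cyc x y z).filter (fun p => p.1 = t)).card = 1 := fun t h => Finset.card_eq_one.2 h
  refine ⟨?_, ?_, ?_⟩
  · exact Finset.card_eq_three.2 ⟨_, _, _, by simp [hxy], by simp [hxz], by simp [hyz], rfl⟩
  · intro q hq
    simp only [Cyc, Finset.mem_insert, Finset.mem_singleton] at hq
    rcases hq with rfl | rfl | rfl <;> simp [hxy, hyz, hxz.symm]
  · intro t ht
    simp only [Finset.mem_insert, Finset.mem_singleton] at ht
    rw [Finset.card_eq_one, Finset.card_eq_one]
    rcases ht with rfl | rfl | rfl
    · exact ⟨⟨(t, y), by ext ⟨u, w⟩; simp [Cyc]; grind⟩, ⟨(z, t), by ext ⟨u, w⟩; simp [Cyc]; grind⟩⟩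
    · exact ⟨⟨(t, z), by ext ⟨u, w⟩; simp [Cyc]; grind⟩, ⟨(x, t), by ext ⟨u, w⟩; simp [Cyc]; grind⟩⟩
    · exact ⟨⟨(t, x), by ext ⟨u, w⟩; simp [Cyc]; grind⟩, ⟨(y, t), by ext ⟨u, w⟩; simp [Cyc]; grind⟩⟩

lemma isCyclic_cases {x y z : V} {d : Finset (V × V)} (hxy : x ≠ y) (hxz : x ≠ z) (hyz : y ≠ z)
    (h : IsCyclicOrientation {x, y, z} d) : d = Cyc x y z ∨ d = Cyc y x z := by
  obtain ⟨hc, hm, hd⟩ := h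
  have out : ∀ t ∈ ({x, y, z} : Finset V), ∃ w, (t, w) ∈ d := by
    intro t ht
    obtain ⟨q, hq⟩ := Finset.card_eq_one.1 (hd t ht).1
    have : q ∈ d.filter (fun p => p.1 = t) := by rw [hq]; simp
    rw [Finset.mem_filter] at this
    exact ⟨q.2, by rw [← this.2]; exact this.1⟩
  have inj : ∀ s t w, (s, w) ∈ d → (t, w) ∈ d → s = t := by
    intro s t w h1 h2
    have hw : w ∈ ({x, y, z} : Finset V) := (hm _ h1).2.1
    obtain ⟨q, hq⟩ := Finset.card_eq_one.1 (hd w hw).2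
    have a1 : (s, w) ∈ d.filter (fun p => p.2 = w) := by rw [Finset.mem_filter]; exact ⟨h1, rfl⟩
    have a2 : (t, w) ∈ d.filter (fun p => p.2 = w) := by rw [Finset.mem_filter]; exact ⟨h2, rfl⟩
    rw [hq, Finset.mem_singleton] at a1 a2
    have := a1.trans a2.symm
    exact congrArg Prod.fst this
  obtain ⟨u, hu⟩ := out x (by simp)
  obtain ⟨v, hv⟩ := out y (by simp)
  obtain ⟨w, hw⟩ := out z (by simp)
  have m1 := hm _ hu
  have m2 := hm _ hv
  have m3 := hm _ hw
  simp only [Finset.mem_insert, Finset.mem_singleton] at m1 m2 m3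
  have i1 := inj x y u hu
  have i2 := inj x z u hu
  have i3 := inj y z v hv
  have key : ∀ s t r : V × V, s ∈ d → t ∈ d → r ∈ d → s ≠ t → s ≠ r → t ≠ r → d = {s, t, r} := by
    intro s t r h1 h2 h3 n1 n2 n3
    exact eq_triple hc h1 h2 h3 n1 n2 n3
  have kd := key _ _ _ hu hv hw (by simp [hxy]) (by simp [hxz]) (by simp [hyz])
  have : (u = y ∧ v = z ∧ w = x) ∨ (u = z ∧ v = x ∧ w = y) := by
    clear key kd hd hm inj out hc
    rcases m1.2.1 with rfl | rfl | rfl <;> rcases m2.2.1 with rfl | rfl | rfl <;>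
      rcases m3.2.1 with rfl | rfl | rfl <;> simp_all
  rcases this with ⟨rfl, rfl, rfl⟩ | ⟨rfl, rfl, rfl⟩
  · left; exact kd
  · right; exact kd.trans (Finset.insert_comm _ _ _)

lemma cyc_total {F : Finset V} (hF : F.card = 3) {d : Finset (V × V)}
    (h : IsCyclicOrientation F d) {x y : V} (hx : x ∈ F) (hy : y ∈ F) (hxy : x ≠ y) :
    (x, y) ∈ d ∨ (y, x) ∈ d := by
  obtain ⟨z, hzx, hzy, rfl⟩ := exists_third hF hx hy hxy
  rcases isCyclic_cases hxy hzx.symm hzy.symm h with rfl | rfl <;> simp [Cyc]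

lemma cyc_antisymm {F : Finset V} (hF : F.card = 3) {d : Finset (V × V)}
    (h : IsCyclicOrientation F d) {x y : V} (h1 : (x, y) ∈ d) (h2 : (y, x) ∈ d) : False := by
  obtain ⟨hx, hy, hxy⟩ := h.2.1 _ h1
  simp only at hx hy hxy
  obtain ⟨z, hzx, hzy, rfl⟩ := exists_third hF hx hy hxy
  rcases isCyclic_cases hxy hzx.symm hzy.symm h with rfl | rfl <;> simp [Cyc] at h1 h2 <;> grind

/-- In an oriented triangle `xyz`, `x → y` forces `z → x`. -/
lemma cyc_next {x y z : V} {d : Finset (V × V)} (hxy : x ≠ y) (hxz : x ≠ z) (hyz : y ≠ z)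
    (h : IsCyclicOrientation {x, y, z} d) (h1 : (x, y) ∈ d) : d = Cyc x y z := by
  rcases isCyclic_cases hxy hxz hyz h with h2 | h2
  · exact h2
  · subst h2; simp [Cyc] at h1; grind

lemma cyc_prev {x y z : V} {d : Finset (V × V)} (hxy : x ≠ y) (hxz : x ≠ z) (hyz : y ≠ z)
    (h : IsCyclicOrientation {x, y, z} d) (h1 : (y, x) ∈ d) : d = Cyc y x z := by
  rcases isCyclic_cases hxy hxz hyz h with h2 | h2
  · subst h2; simp [Cyc] at h1; grind
  · exact h2

lemma cyc_image (f : V → V) (x y z : V) :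
    (Cyc x y z).image (Prod.map f f) = Cyc (f x) (f y) (f z) := by
  simp [Cyc, Finset.image_insert]

lemma phi_ne {a c : V} {F : Finset V} (h : ¬ (a ∈ F ∧ c ∈ F)) {x y : V} (hx : x ∈ F)
    (hy : y ∈ F) (hxy : x ≠ y) : phi a c x ≠ phi a c y := by
  simp only [phi]
  split_ifs <;> grind

namespace Ctx

variable {faces : Finset (Finset V)} {a c b e : V} {n : ℕ} {p : ℕ → V}

lemma orient_fwd (X : Ctx faces a c b e n p) (h : Orientable faces) :
    Orientable (contract faces a c) := by
  obtain ⟨o, ho, hd⟩ := h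
  have hac := X.hac
  have ex : ∀ G : Finset V, ∃ d, ∀ F ∈ faces, ¬ (a ∈ F ∧ c ∈ F) → F.image (phi a c) = G →
      d = (o F).image (Prod.map (phi a c) (phi a c)) := by
    intro G
    by_cases hG : ∃ F ∈ faces, ¬ (a ∈ F ∧ c ∈ F) ∧ F.image (phi a c) = G
    · obtain ⟨F, hF, hFr, hFG⟩ := hG
      refine ⟨(o F).image (Prod.map (phi a c) (phi a c)), fun F' hF' hr' hG' => ?_⟩
      rw [X.phi_inj hF hF' hFr hr' (hFG.trans hG'.symm)]
    · exact ⟨∅, fun F h1 h2 h3 => (hG ⟨F, h1, h2, h3⟩).elim⟩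
  choose o' ho' using ex
  have key : ∀ F ∈ faces, ∀ G ∈ faces, ¬ (a ∈ F ∧ c ∈ F) → ¬ (a ∈ G ∧ c ∈ G) → ∀ x : V,
      (((a, x) ∈ o F ∧ (c, x) ∈ o G) ∨ ((x, a) ∈ o F ∧ (x, c) ∈ o G)) → False := by
    intro F hF G hG hFr hGr x hx
    have hmem : a ∈ F ∧ x ∈ F ∧ c ∈ G ∧ x ∈ G ∧ x ≠ a ∧ x ≠ c := by
      rcases hx with ⟨h1, h2⟩ | ⟨h1, h2⟩
      · have m1 := (ho F hF).2.1 _ h1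
        have m2 := (ho G hG).2.1 _ h2
        simp only at m1 m2
        exact ⟨m1.1, m1.2.1, m2.1, m2.2.1, m1.2.2.symm, m2.2.2.symm⟩
      · have m1 := (ho F hF).2.1 _ h1
        have m2 := (ho G hG).2.1 _ h2
        simp only at m1 m2
        exact ⟨m1.2.1, m1.1, m2.2.1, m2.1, m1.2.2, m2.2.2⟩
    obtain ⟨haF, hxF, hcG, hxG, hxa, hxc⟩ := hmem
    have hT : ({a, c, x} : Finset V) ∈ faces := by
      rcases X.common x F hF G hG haF hxF hcG hxG hxa hxc with rfl | rfl
      · exact X.fb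
      · exact X.fe
    have hF' : F ≠ {a, c, x} := by rintro rfl; simp at hFr
    have hG' : G ≠ {a, c, x} := by rintro rfl; simp at hGr
    have t1 := cyc_total (X.T.card_three _ hT) (ho _ hT) (x := a) (y := x) (by simp) (by simp) hxa.symm
    have t2 := cyc_total (X.T.card_three _ hT) (ho _ hT) (x := c) (y := x) (by simp) (by simp) hxc.symm
    have d1 := hd F hF _ hT hF'
    have d2 := hd G hG _ hT hG'
    have hcyc := isCyclic_cases hac hxa.symm hxc.symm (ho _ hT)
    rcases hx with ⟨h1, h2⟩ | ⟨h1, h2⟩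
    · have n1 := d1 _ h1
      have n2 := d2 _ h2
      rcases hcyc with h | h <;> rw [h] at n1 n2 <;> simp [Cyc] at n1 n2
    · have n1 := d1 _ h1
      have n2 := d2 _ h2
      rcases hcyc with h | h <;> rw [h] at n1 n2 <;> simp [Cyc] at n1 n2
  refine ⟨o', ?_, ?_⟩
  · intro G hG
    obtain ⟨F, hF, hFr, rfl⟩ := (mem_contract _ _ _ _).1 hG
    rw [ho' _ F hF hFr rfl]
    obtain ⟨x, y, z, hxy, hxz, hyz, rfl⟩ := Finset.card_eq_three.1 (X.T.card_three F hF)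
    have n1 := phi_ne hFr (x := x) (y := y) (by simp) (by simp) hxy
    have n2 := phi_ne hFr (x := x) (y := z) (by simp) (by simp) hxz
    have n3 := phi_ne hFr (x := y) (y := z) (by simp) (by simp) hyz
    rcases isCyclic_cases hxy hxz hyz (ho _ hF) with h | h
    · rw [h, cyc_image]
      simpa [Finset.image_insert] using cyc_isCyclic n1 n2 n3
    · rw [h, cyc_image]
      have := cyc_isCyclic n1.symm n3 n2
      rw [show ({phi a c y, phi a c x, phi a c z} : Finset V) =
        {phi a c x, phi a c y, phi a c z} from by ext; simp; tauto] at this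
      simpa [Finset.image_insert] using this
  · intro F' hF' G' hG' hne q hq hq'
    obtain ⟨F, hF, hFr, rfl⟩ := (mem_contract _ _ _ _).1 hF'
    obtain ⟨G, hG, hGr, rfl⟩ := (mem_contract _ _ _ _).1 hG'
    rw [ho' _ F hF hFr rfl] at hq
    rw [ho' _ G hG hGr rfl] at hq'
    have hFG : F ≠ G := by rintro rfl; exact hne rfl
    obtain ⟨⟨s, t⟩, hst, hq⟩ := Finset.mem_image.1 hq
    obtain ⟨⟨u, w⟩, huw, hq'⟩ := Finset.mem_image.1 hq'
    have heq := hq.trans hq'.symm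
    simp only [Prod.map, Prod.mk.injEq] at heq
    obtain ⟨e1, e2⟩ := heq
    have m1 := (ho F hF).2.1 _ hst
    have m2 := (ho G hG).2.1 _ huw
    have hdd := hd F hF G hG hFG _ hst
    simp only at m1 m2
    have k1 := key F hF G hG hFr hGr
    have k2 := key G hG F hF hGr hFr
    simp only [phi] at e1 e2
    split_ifs at e1 e2 <;> grind

/-- Backward transfer of orientations, given the behaviour at the two special faces. -/
lemma orient_back_aux (X : Ctx faces a c b e n p) (o' : Finset V → Finset (V × V))
    (ho : ∀ F ∈ contract faces a c, IsCyclicOrientation F (o' F))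
    (hd : ∀ F ∈ contract faces a c, ∀ G ∈ contract faces a c, F ≠ G → ∀ p ∈ o' F, p ∉ o' G)
    (b' e' : V) (hbe' : (b' = b ∧ e' = e) ∨ (b' = e ∧ e' = b))
    (hB : ∀ F ∈ faces, c ∉ F → a ∈ F → b' ∈ F → (a, b') ∈ o' F)
    (hE : ∀ F ∈ faces, c ∉ F → a ∈ F → e' ∈ F → (e', a) ∈ o' F) :
    Orientable faces := by
  have hac := X.hac
  have hab' : a ≠ b' := by have := X.hab; have := X.hae; grind
  have hae' : a ≠ e' := by have := X.hab; have := X.hae; grind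
  have hcb' : c ≠ b' := by have := X.hcb; have := X.hce; grind
  have hce' : c ≠ e' := by have := X.hcb; have := X.hce; grind
  have hne' : b' ≠ e' := by have := X.hbe; grind
  have fb' : ({a, c, b'} : Finset V) ∈ faces := by
    rcases hbe' with ⟨rfl, rfl⟩ | ⟨rfl, rfl⟩
    · exact X.fb
    · exact X.fe
  have fe' : ({a, c, e'} : Finset V) ∈ faces := by
    rcases hbe' with ⟨rfl, rfl⟩ | ⟨rfl, rfl⟩
    · exact X.fe
    · exact X.fb
  have hacf : ∀ F ∈ faces, a ∈ F → c ∈ F → F = {a, c, b'} ∨ F = {a, c, e'} := by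
    intro F hF h1 h2
    have := X.ac_face hF h1 h2
    rcases hbe' with ⟨rfl, rfl⟩ | ⟨rfl, rfl⟩
    · exact this
    · exact this.symm
  have hmk : ∀ G ∈ faces, ¬ (a ∈ G ∧ c ∈ G) → G.image (phi a c) ∈ contract faces a c :=
    fun G h1 h2 => (mem_contract _ _ _ _).2 ⟨G, h1, h2, rfl⟩
  have hface_ne : ({a, c, b'} : Finset V) ≠ {a, c, e'} := by
    intro h
    have : e' ∈ ({a, c, b'} : Finset V) := by rw [h]; simp
    simp at this
    grind
  -- a face on `c x` in the contraction is oriented oppositely to the face on `a x`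
  have hother : ∀ x, a ≠ x → c ≠ x → ({a, c, x} : Finset V) ∈ faces → ∀ F ∈ faces, a ∉ F → c ∈ F →
      x ∈ F → ∃ A ∈ faces, c ∉ A ∧ a ∈ A ∧ x ∈ A ∧
        (∀ q ∈ o' A, q ∉ o' (F.image (phi a c))) := by
    intro x hax hcx hT F hF haF hcF hxF
    obtain ⟨A, hA, hAne, haA, hxA, hAall⟩ :=
      other_face X.T hT (x := a) (y := x) hax (by simp) (by simp)
    have hcA : c ∉ A := fun h => hAne
        (eq_triple (X.T.card_three A hA) haA h hxA hac hax hcx)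
    refine ⟨A, hA, hcA, haA, hxA, ?_⟩
    have hAm := hmk A hA (by tauto)
    rw [phi_fix A hcA] at hAm
    apply hd A hAm _ (hmk F hF (by tauto))
    intro h
    rw [← phi_fix (a := a) A hcA] at h
    have := X.phi_inj hA hF (by tauto) (by tauto) h
    subst this; exact haF haA
  -- directed edges at the special vertices inside the contraction
  have hB2 : ∀ F ∈ faces, ¬ (a ∈ F ∧ c ∈ F) → c ∈ F → b' ∈ F →
      (b', a) ∈ o' (F.image (phi a c)) := by
    intro F hF hFr hcF hbF
    have haF : a ∉ F := fun h => hFr ⟨h, hcF⟩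
    obtain ⟨A, hA, hcA, haA, hxA, hq⟩ := hother b' hab' hcb' fb' F hF haF hcF hbF
    have := hq _ (hB A hA hcA haA hxA)
    rcases cyc_total (X.card_three' _ (hmk F hF hFr)) (ho _ (hmk F hF hFr)) (x := a) (y := b')
      (by rw [mem_phi hac]; tauto) (by rw [mem_phi hac]; exact Or.inl ⟨hcb'.symm, hbF⟩) hab' with h | h
    · exact (this h).elim
    · exact h
  have hE2 : ∀ F ∈ faces, ¬ (a ∈ F ∧ c ∈ F) → c ∈ F → e' ∈ F →
      (a, e') ∈ o' (F.image (phi a c)) := by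
    intro F hF hFr hcF heF
    have haF : a ∉ F := fun h => hFr ⟨h, hcF⟩
    obtain ⟨A, hA, hcA, haA, hxA, hq⟩ := hother e' hae' hce' fe' F hF haF hcF heF
    have := hq _ (hE A hA hcA haA hxA)
    rcases cyc_total (X.card_three' _ (hmk F hF hFr)) (ho _ (hmk F hF hFr)) (x := a) (y := e')
      (by rw [mem_phi hac]; tauto) (by rw [mem_phi hac]; exact Or.inl ⟨hce'.symm, heF⟩) hae' with h | h
    · exact h
    · exact (this h).elim
  have ex : ∀ F : Finset V, ∃ d, F ∈ faces → (IsCyclicOrientation F d ∧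
      (¬ (a ∈ F ∧ c ∈ F) → d.image (Prod.map (phi a c) (phi a c)) = o' (F.image (phi a c))) ∧
      (F = {a, c, b'} → d = Cyc a c b') ∧ (F = {a, c, e'} → d = Cyc c a e')) := by
    intro F
    by_cases hF : F ∈ faces
    swap
    · exact ⟨∅, fun h => (hF h).elim⟩
    by_cases hFr : a ∈ F ∧ c ∈ F
    · rcases hacf F hF hFr.1 hFr.2 with h | h
      · refine ⟨Cyc a c b', fun _ => ⟨?_, fun h => (h hFr).elim, fun _ => rfl,
          fun h' => (hface_ne (h.symm.trans h')).elim⟩⟩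
        rw [h]
        exact cyc_isCyclic hac hab' hcb'
      · refine ⟨Cyc c a e', fun _ => ⟨?_, fun h => (h hFr).elim,
          fun h' => (hface_ne (h'.symm.trans h)).elim, fun _ => rfl⟩⟩
        rw [h, show ({a, c, e'} : Finset V) = {c, a, e'} from Finset.insert_comm _ _ _]
        exact cyc_isCyclic hac.symm hce' hae'
    · have sp : ∀ x, F ≠ {a, c, x} := by
        rintro x rfl; simp at hFr
      have hm := ho _ (hmk F hF hFr)
      obtain ⟨x, y, z, hxy, hxz, hyz, h3⟩ := Finset.card_eq_three.1 (X.T.card_three F hF)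
      have n1 := phi_ne hFr (x := x) (y := y) (by simp [h3]) (by simp [h3]) hxy
      have n2 := phi_ne hFr (x := x) (y := z) (by simp [h3]) (by simp [h3]) hxz
      have n3 := phi_ne hFr (x := y) (y := z) (by simp [h3]) (by simp [h3]) hyz
      have him : F.image (phi a c) = {phi a c x, phi a c y, phi a c z} := by
        rw [h3]; simp [Finset.image_insert]
      rw [him] at hm
      rcases isCyclic_cases n1 n2 n3 hm with h | h
      · refine ⟨Cyc x y z, fun _ => ⟨?_, fun _ => ?_, fun h => (sp _ h).elim, fun h => (sp _ h).elim⟩⟩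
        · rw [h3]; exact cyc_isCyclic hxy hxz hyz
        · rw [him, h, cyc_image]
      · refine ⟨Cyc y x z, fun _ => ⟨?_, fun _ => ?_, fun h => (sp _ h).elim, fun h => (sp _ h).elim⟩⟩
        · rw [h3, Finset.insert_comm]; exact cyc_isCyclic hxy.symm hyz hxz
        · rw [him, h, cyc_image]
  choose o hoo using ex
  have push : ∀ F ∈ faces, ¬ (a ∈ F ∧ c ∈ F) → ∀ s t, (s, t) ∈ o F →
      (phi a c s, phi a c t) ∈ o' (F.image (phi a c)) := by
    intro F hF hFr s t h
    rw [← (hoo F hF).2.1 hFr]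
    exact Finset.mem_image.2 ⟨(s, t), h, rfl⟩
  have pa : phi a c a = a := by simp [phi]
  have pcc : phi a c c = a := by simp [phi]
  have pb : phi a c b' = b' := by simp [phi, hcb'.symm]
  have pe : phi a c e' = e' := by simp [phi, hce'.symm]
  have spB : ∀ G ∈ faces, ¬ (a ∈ G ∧ c ∈ G) → ∀ q, q ∈ Cyc a c b' → q ∈ o G → False := by
    rintro G hG hGr ⟨s, t⟩ hq hqG
    have m := (hoo G hG).1.2.1 _ hqG
    have hp := push G hG hGr s t hqG
    have anti := fun {x y : V} => cyc_antisymm (X.card_three' _ (hmk G hG hGr)) (ho _ (hmk G hG hGr))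
      (x := x) (y := y)
    simp only [Cyc, Finset.mem_insert, Finset.mem_singleton, Prod.mk.injEq] at hq
    rcases hq with ⟨rfl, rfl⟩ | ⟨rfl, rfl⟩ | ⟨rfl, rfl⟩
    · exact hGr ⟨m.1, m.2.1⟩
    · rw [pcc, pb] at hp
      exact anti hp (hB2 G hG hGr m.1 m.2.1)
    · rw [pa, pb] at hp
      have hcG : c ∉ G := fun h => hGr ⟨m.2.1, h⟩
      have := hB G hG hcG m.2.1 m.1
      rw [phi_fix G hcG] at hp anti
      exact anti hp this
  have spE : ∀ G ∈ faces, ¬ (a ∈ G ∧ c ∈ G) → ∀ q, q ∈ Cyc c a e' → q ∈ o G → False := by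
    rintro G hG hGr ⟨s, t⟩ hq hqG
    have m := (hoo G hG).1.2.1 _ hqG
    have hp := push G hG hGr s t hqG
    have anti := fun {x y : V} => cyc_antisymm (X.card_three' _ (hmk G hG hGr)) (ho _ (hmk G hG hGr))
      (x := x) (y := y)
    simp only [Cyc, Finset.mem_insert, Finset.mem_singleton, Prod.mk.injEq] at hq
    rcases hq with ⟨rfl, rfl⟩ | ⟨rfl, rfl⟩ | ⟨rfl, rfl⟩
    · exact hGr ⟨m.2.1, m.1⟩
    · rw [pa, pe] at hp
      have hcG : c ∉ G := fun h => hGr ⟨m.1, h⟩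
      have := hE G hG hcG m.1 m.2.1
      rw [phi_fix G hcG] at hp anti
      exact anti hp this
    · rw [pcc, pe] at hp
      exact anti hp (hE2 G hG hGr m.2.1 m.1)
  have spBE : ∀ q, q ∈ Cyc a c b' → q ∈ Cyc c a e' → False := by
    rintro ⟨s, t⟩ h1 h2
    simp only [Cyc, Finset.mem_insert, Finset.mem_singleton, Prod.mk.injEq] at h1 h2
    grind
  have sp : ∀ F ∈ faces, a ∈ F ∧ c ∈ F →
      (F = {a, c, b'} ∧ o F = Cyc a c b') ∨ (F = {a, c, e'} ∧ o F = Cyc c a e') := by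
    intro F hF h
    rcases hacf F hF h.1 h.2 with h | h
    · exact Or.inl ⟨h, (hoo F hF).2.2.1 h⟩
    · exact Or.inr ⟨h, (hoo F hF).2.2.2 h⟩
  refine ⟨o, fun F hF => (hoo F hF).1, ?_⟩
  intro F hF G hG hne q hqF hqG
  by_cases hFr : a ∈ F ∧ c ∈ F <;> by_cases hGr : a ∈ G ∧ c ∈ G
  · rcases sp F hF hFr with ⟨h1, h2⟩ | ⟨h1, h2⟩ <;> rcases sp G hG hGr with ⟨h3, h4⟩ | ⟨h3, h4⟩
    · exact hne (h1.trans h3.symm)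
    · rw [h2] at hqF; rw [h4] at hqG; exact spBE q hqF hqG
    · rw [h2] at hqF; rw [h4] at hqG; exact spBE q hqG hqF
    · exact hne (h1.trans h3.symm)
  · rcases sp F hF hFr with ⟨h1, h2⟩ | ⟨h1, h2⟩
    · rw [h2] at hqF; exact spB G hG hGr q hqF hqG
    · rw [h2] at hqF; exact spE G hG hGr q hqF hqG
  · rcases sp G hG hGr with ⟨h1, h2⟩ | ⟨h1, h2⟩
    · rw [h2] at hqG; exact spB F hF hFr q hqG hqF
    · rw [h2] at hqG; exact spE F hF hFr q hqG hqF
  · refine hd _ (hmk F hF hFr) _ (hmk G hG hGr) ?_ _ (push F hF hFr q.1 q.2 hqF)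
      (push G hG hGr q.1 q.2 hqG)
    intro h
    exact hne (X.phi_inj hF hG hFr hGr h)

lemma path_distinct (X : Ctx faces a c b e n p) {i : ℕ} (hi : i < n) :
    a ≠ p i ∧ a ≠ p (i + 1) ∧ p i ≠ p (i + 1) := by
  have h3 := X.T.card_three _ (X.pf i hi)
  refine ⟨?_, ?_, ?_⟩ <;> intro h <;> rw [← h] at h3
  · have : ({a, a, p (i + 1)} : Finset V) = {a, p (i + 1)} := by ext; simp
    rw [this] at h3
    have := Finset.card_le_two (a := a) (b := p (i + 1))
    omega
  · have : ({a, p i, a} : Finset V) = {a, p i} := by ext; simp; tauto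
    rw [this] at h3
    have := Finset.card_le_two (a := a) (b := p i)
    omega
  · have : ({a, p i, p i} : Finset V) = {a, p i} := by ext; simp
    rw [this] at h3
    have := Finset.card_le_two (a := a) (b := p i)
    omega

lemma orient_back (X : Ctx faces a c b e n p) (h : Orientable (contract faces a c)) :
    Orientable faces := by
  obtain ⟨o', ho, hd⟩ := h
  have hn := X.hn
  have hpn : p (n - 1 + 1) = e := by rw [Nat.sub_add_cancel hn, X.pn]
  -- uniqueness of the faces avoiding `c` on `a b` and `a e`
  have uniq : ∀ x, a ≠ x → c ≠ x → ({a, c, x} : Finset V) ∈ faces → ∀ F ∈ faces, ∀ G ∈ faces,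
      c ∉ F → c ∉ G → a ∈ F → a ∈ G → x ∈ F → x ∈ G → F = G := by
    intro x hax hcx hT F hF G hG hcF hcG haF haG hxF hxG
    obtain ⟨A, hA, hAne, haA, hxA, hAall⟩ :=
      other_face X.T hT (x := a) (y := x) hax (by simp) (by simp)
    have h1 := hAall F hF haF hxF
    have h2 := hAall G hG haG hxG
    have : c ∈ ({a, c, x} : Finset V) := by simp
    grind
  have last : ∀ F ∈ faces, c ∉ F → a ∈ F → e ∈ F → F = {a, p (n - 1), p (n - 1 + 1)} := by
    intro F hF h1 h2 h3
    exact uniq e X.hae X.hce X.fe F hF _ (X.pf (n - 1) (by omega)) h1 (X.c_ne_path (by omega)) h2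
      (by simp) h3 (by simp [hpn])
  have first : ∀ F ∈ faces, c ∉ F → a ∈ F → b ∈ F → F = {a, p 0, p (0 + 1)} := by
    intro F hF h1 h2 h3
    exact uniq b X.hab X.hcb X.fb F hF _ (X.pf 0 (by omega)) h1 (X.c_ne_path (by omega)) h2
      (by simp) h3 (by simp [X.p0])
  obtain ⟨d1, d2, d3⟩ := X.path_distinct (i := 0) (by omega)
  rcases cyc_total (X.T.card_three _ (X.pf 0 (by omega))) (ho _ (X.path_mem (i := 0) (by omega)))
    (x := a) (y := p 0) (by simp) (by simp) d1 with h0 | h0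
  · have ind : ∀ i < n, (a, p i) ∈ o' {a, p i, p (i + 1)} ∧
        (p (i + 1), a) ∈ o' {a, p i, p (i + 1)} := by
      intro i
      induction i with
      | zero =>
        intro hi
        refine ⟨h0, ?_⟩
        rw [cyc_next d1 d2 d3 (ho _ (X.path_mem (i := 0) (by omega))) h0]
        simp [Cyc]
      | succ i ih =>
        intro hi
        obtain ⟨e1, e2, e3⟩ := X.path_distinct hi
        have ih' := (ih (by omega)).2
        have := hd _ (X.path_mem (i := i) (by omega)) _ (X.path_mem hi) (X.pne i hi) _ ih'
        have h1 : (a, p (i + 1)) ∈ o' {a, p (i + 1), p (i + 1 + 1)} := by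
          rcases cyc_total (X.T.card_three _ (X.pf _ hi)) (ho _ (X.path_mem hi))
            (x := a) (y := p (i + 1)) (by simp) (by simp) e1 with h | h
          · exact h
          · exact (this h).elim
        refine ⟨h1, ?_⟩
        rw [cyc_next e1 e2 e3 (ho _ (X.path_mem hi)) h1]
        simp [Cyc]
    refine X.orient_back_aux o' ho hd b e (Or.inl ⟨rfl, rfl⟩) ?_ ?_
    · intro F hF h1 h2 h3
      rw [first F hF h1 h2 h3, ← X.p0]; exact h0
    · intro F hF h1 h2 h3
      have := (ind (n - 1) (by omega)).2
      rw [last F hF h1 h2 h3]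
      rwa [hpn] at this ⊢
  · have ind : ∀ i < n, (p i, a) ∈ o' {a, p i, p (i + 1)} ∧
        (a, p (i + 1)) ∈ o' {a, p i, p (i + 1)} := by
      intro i
      induction i with
      | zero =>
        intro hi
        refine ⟨h0, ?_⟩
        rw [cyc_prev d1 d2 d3 (ho _ (X.path_mem (i := 0) (by omega))) h0]
        simp [Cyc]
      | succ i ih =>
        intro hi
        obtain ⟨e1, e2, e3⟩ := X.path_distinct hi
        have ih' := (ih (by omega)).2
        have := hd _ (X.path_mem (i := i) (by omega)) _ (X.path_mem hi) (X.pne i hi) _ ih'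
        have h1 : (p (i + 1), a) ∈ o' {a, p (i + 1), p (i + 1 + 1)} := by
          rcases cyc_total (X.T.card_three _ (X.pf _ hi)) (ho _ (X.path_mem hi))
            (x := a) (y := p (i + 1)) (by simp) (by simp) e1 with h | h
          · exact (this h).elim
          · exact h
        refine ⟨h1, ?_⟩
        rw [cyc_prev e1 e2 e3 (ho _ (X.path_mem hi)) h1]
        simp [Cyc]
    refine X.orient_back_aux o' ho hd e b (Or.inr ⟨rfl, rfl⟩) ?_ ?_
    · intro F hF h1 h2 h3
      have := (ind (n - 1) (by omega)).2
      rw [last F hF h1 h2 h3]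
      rwa [hpn] at this ⊢
    · intro F hF h1 h2 h3
      rw [first F hF h1 h2 h3, ← X.p0]; exact h0

lemma mem_edgeSet {S : Finset (Finset V)} {x y : V} (hxy : x ≠ y) :
    ({x, y} : Finset V) ∈ edgeSet S ↔ ∃ F ∈ S, x ∈ F ∧ y ∈ F := by
  simp only [edgeSet, Finset.mem_filter, Finset.mem_powersetCard, Finset.insert_subset_iff,
    Finset.singleton_subset_iff, Finset.card_pair hxy, vertexSet, Finset.mem_biUnion, id]
  constructor
  · rintro ⟨_, h⟩; exact h
  · rintro ⟨F, hF, h1, h2⟩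
    exact ⟨⟨⟨⟨F, hF, h1⟩, ⟨F, hF, h2⟩⟩, trivial⟩, F, hF, h1, h2⟩

lemma contractible (X : Ctx faces a c b e n p) : Contractible faces a c :=
  ⟨(mem_edgeSet X.hac).2 ⟨_, X.fb, by simp, by simp⟩, X.isTri', X.euler',
    X.orient_back, X.orient_fwd⟩

end Ctx

lemma K4_euler {faces : Finset (Finset V)} (T : IsTriangulation faces) {K : Finset V}
    (hK : K.card = 4) (hin : ∀ t ∈ K, K.erase t ∈ faces) : eulerChar faces = 2 := by
  have hin2 : ∀ F ⊆ K, F.card = 3 → F ∈ faces := by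
    intro F hF hc
    obtain ⟨t, ht, htF⟩ : ∃ t ∈ K, t ∉ F := by
      by_contra hcon
      push Not at hcon
      have := Finset.card_le_card (show K ⊆ F from hcon)
      omega
    have : F = K.erase t := by
      apply Finset.eq_of_subset_of_card_le
      · intro x hx
        exact Finset.mem_erase.2 ⟨by rintro rfl; exact htF hx, hF hx⟩
      · rw [Finset.card_erase_of_mem ht]; omega
    rw [this]; exact hin t ht
  have closed : ∀ G ∈ faces, ∀ x y, x ≠ y → x ∈ G → y ∈ G → x ∈ K → y ∈ K → G ⊆ K := by
    intro G hG x y hxy hxG hyG hxK hyK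
    have hsub : ({x, y} : Finset V) ⊆ K := by
      intro t ht; simp at ht; grind
    have h2 : (K \ {x, y}).card = 2 := by
      rw [Finset.card_sdiff_of_subset hsub, Finset.card_pair hxy, hK]
    obtain ⟨z, w, hzw, hE⟩ := Finset.card_eq_two.1 h2
    have hz : z ∈ K \ {x, y} := by rw [hE]; simp
    have hw : w ∈ K \ {x, y} := by rw [hE]; simp
    simp at hz hw
    have f1s : ({x, y, z} : Finset V) ⊆ K := by intro t ht; simp at ht; grind
    have f2s : ({x, y, w} : Finset V) ⊆ K := by intro t ht; simp at ht; grind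
    have f1 := hin2 _ f1s (Finset.card_eq_three.2 ⟨x, y, z, hxy, by grind, by grind, rfl⟩)
    have f2 := hin2 _ f2s (Finset.card_eq_three.2 ⟨x, y, w, hxy, by grind, by grind, rfl⟩)
    obtain ⟨A, hA, hne, _, _, hall⟩ := other_face T f1 hxy (by simp) (by simp)
    have hne2 : ({x, y, w} : Finset V) ≠ {x, y, z} := by
      intro h
      have : w ∈ ({x, y, z} : Finset V) := by rw [← h]; simp
      simp at this
      grind
    have g1 := hall _ f2 (by simp) (by simp)
    have g2 := hall G hG hxG hyG
    rcases g2 with rfl | rfl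
    · exact f1s
    · rcases g1 with h | h
      · exact (hne2 h).elim
      · rw [← h]; exact f2s
  obtain ⟨t0, ht0⟩ := Finset.card_pos.1 (by omega : 0 < K.card)
  have all : ∀ G ∈ faces, G ⊆ K := by
    intro G hG
    have hpath := T.connected _ (hin t0 ht0) G hG
    clear hG
    induction hpath with
    | refl => exact Finset.erase_subset _ _
    | tail _ hst ih =>
      obtain ⟨hA, hB, hcard⟩ := hst
      obtain ⟨x, hx, y, hy, hxy⟩ := Finset.one_lt_card.1 (show 1 < Finset.card _ from hcard ▸ one_lt_two)
      rw [Finset.mem_inter] at hx hy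
      exact closed _ hB x y hxy hx.2 hy.2 (ih hx.1) (ih hy.1)
  have hfaces : faces = K.powersetCard 3 := by
    ext F
    rw [Finset.mem_powersetCard]
    exact ⟨fun h => ⟨all F h, T.card_three F h⟩, fun h => hin2 F h.1 h.2⟩
  have hfc : faces.card = 4 := by
    rw [hfaces, Finset.card_powersetCard, hK]; rfl
  have hvs : vertexSet faces = K := by
    ext x
    simp only [vertexSet, Finset.mem_biUnion, id]
    constructor
    · rintro ⟨F, hF, hx⟩; exact all F hF hx
    · intro hx
      obtain ⟨t, ht, htx⟩ := Finset.exists_mem_ne (by omega : 1 < K.card) x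
      exact ⟨K.erase t, hin t ht, Finset.mem_erase.2 ⟨htx.symm, hx⟩⟩
  have h3 := three_mul_faces T
  unfold eulerChar
  rw [hvs, hK, hfc]
  omega

lemma triCycle_of {faces : Finset (Finset V)} {x y z : V} (hxy : x ≠ y) (hxz : x ≠ z)
    (hyz : y ≠ z) (h1 : ∃ F ∈ faces, x ∈ F ∧ y ∈ F) (h2 : ∃ F ∈ faces, x ∈ F ∧ z ∈ F)
    (h3 : ∃ F ∈ faces, y ∈ F ∧ z ∈ F) : IsTriCycle faces {x, y, z} := by
  refine ⟨Finset.card_eq_three.2 ⟨x, y, z, hxy, hxz, hyz, rfl⟩, ?_⟩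
  intro s hs
  rw [Finset.mem_powersetCard] at hs
  obtain ⟨u, w, huw, rfl⟩ := Finset.card_eq_two.1 hs.2
  have hu : u ∈ ({x, y, z} : Finset V) := hs.1 (by simp)
  have hw : w ∈ ({x, y, z} : Finset V) := hs.1 (by simp)
  simp only [Finset.mem_insert, Finset.mem_singleton] at hu hw
  rw [Ctx.mem_edgeSet huw]
  rcases hu with rfl | rfl | rfl <;> rcases hw with rfl | rfl | rfl <;> grind

lemma link_three_le {faces : Finset (Finset V)} (T : IsTriangulation faces) {v : V}
    {d : ℕ} {ℓ : ZMod d → V} (hℓ : IsLink faces v d ℓ) : 3 ≤ d := by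
  obtain ⟨hinj, hne, hF⟩ := hℓ
  have hface : ∀ i, ({v, ℓ i, ℓ (i + 1)} : Finset V) ∈ faces := fun i => ((hF _).2 ⟨i, rfl⟩).1
  by_contra hd
  have : d = 0 ∨ d = 1 ∨ d = 2 := by omega
  rcases this with rfl | rfl | rfl
  · have : Infinite (ZMod 0) := inferInstanceAs (Infinite ℤ)
    have h1 : ((vertexSet faces : Finset V) : Set V).Infinite :=
      Set.infinite_of_injective_forall_mem hinj
        (fun i => Finset.mem_coe.2 (Finset.mem_biUnion.2 ⟨_, hface i, by simp⟩))
    exact h1 (Finset.finite_toSet _)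
  · have h3 := T.card_three _ (hface 0)
    have e1 : (0 : ZMod 1) + 1 = 0 := by decide
    rw [e1] at h3
    have : ({v, ℓ 0, ℓ 0} : Finset V) = {v, ℓ 0} := by ext; simp
    rw [this] at h3
    have := Finset.card_le_two (a := v) (b := ℓ 0)
    omega
  · obtain ⟨G, hG, hGne, hvG, _, _⟩ := other_face T (hface 0) (hne 0).symm (by simp) (by simp)
    obtain ⟨i, rfl⟩ := (hF G).1 ⟨hG, hvG⟩
    have : i = 0 ∨ i = 1 := (by decide : ∀ k : ZMod 2, k = 0 ∨ k = 1) i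
    rcases this with rfl | rfl
    · exact hGne rfl
    · apply hGne
      have e1 : (1 : ZMod 2) + 1 = 0 := by decide
      have e2 : (0 : ZMod 2) + 1 = 1 := by decide
      rw [e1, e2]
      ext; simp; tauto

lemma natCast_inj' {d i j : ℕ} (hi : i < d) (hj : j < d) (h : (i : ZMod d) = (j : ZMod d)) :
    i = j := by
  rw [ZMod.natCast_eq_natCast_iff'] at h
  rwa [Nat.mod_eq_of_lt hi, Nat.mod_eq_of_lt hj] at h

lemma exists_chord_zero {faces : Finset (Finset V)} (h : IrreducibleTri faces)
    (hsphere : eulerChar faces ≠ 2) {v : V} {d : ℕ} {ℓ : ZMod d → V}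
    (hℓ : IsLink faces v d ℓ) : ∃ j, IsNonfacialTriCycle faces {v, ℓ 0, ℓ j} := by
  by_contra hcon
  push Not at hcon
  obtain ⟨T, hirr⟩ := h
  have hd := link_three_le T hℓ
  obtain ⟨hinj, hne, hF⟩ := hℓ
  have hface : ∀ i, ({v, ℓ i, ℓ (i + 1)} : Finset V) ∈ faces := fun i => ((hF _).2 ⟨i, rfl⟩).1
  have hlast : (((d - 1 : ℕ) : ZMod d)) + 1 = 0 := by
    rw [← Nat.cast_add_one, Nat.sub_add_cancel (by omega)]; exact ZMod.natCast_self d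
  have hnat : ∀ i j : ℕ, i < d → j < d → i ≠ j → ℓ (i : ZMod d) ≠ ℓ (j : ZMod d) :=
    fun i j hi hj hij hh => hij (natCast_inj' hi hj (hinj hh))
  have n01 : ℓ 0 ≠ ℓ 1 := by
    have := hnat 0 1 (by omega) (by omega) (by omega)
    simpa using this
  have n0l : ℓ 0 ≠ ℓ ((d - 1 : ℕ) : ZMod d) := by
    have := hnat 0 (d - 1) (by omega) (by omega) (by omega)
    simpa using this
  have n1l : ℓ 1 ≠ ℓ ((d - 1 : ℕ) : ZMod d) := by
    have := hnat 1 (d - 1) (by omega) (by omega) (by omega)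
    simpa using this
  have fb : ({v, ℓ 0, ℓ 1} : Finset V) ∈ faces := by simpa using hface 0
  have fe : ({v, ℓ 0, ℓ ((d - 1 : ℕ) : ZMod d)} : Finset V) ∈ faces := by
    have := hface ((d - 1 : ℕ) : ZMod d)
    rw [hlast] at this
    rwa [Finset.pair_comm (ℓ 0)]
  have X : Ctx faces v (ℓ 0) (ℓ 1) (ℓ ((d - 1 : ℕ) : ZMod d)) (d - 2)
      (fun k => ℓ ((k + 1 : ℕ) : ZMod d)) := by
    refine ⟨T, (hne _).symm, (hne _).symm, (hne _).symm, n01, n0l, n1l, fb, fe, ?_, ?_, by omega,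
      by simp, ?_, ?_, ?_, ?_⟩
    · intro x F hFf G hG hvF hxF hcG hxG hxv hxc
      obtain ⟨i, rfl⟩ := (hF F).1 ⟨hFf, hvF⟩
      obtain ⟨j, rfl⟩ : ∃ j, x = ℓ j := by
        simp only [Finset.mem_insert, Finset.mem_singleton] at hxF
        rcases hxF with h | h | h
        · exact (hxv h).elim
        · exact ⟨_, h⟩
        · exact ⟨_, h⟩
      have htri : IsTriCycle faces {v, ℓ 0, ℓ j} :=
        triCycle_of (hne _).symm (hne _).symm hxc.symm ⟨_, fb, by simp, by simp⟩
          ⟨_, hFf, hvF, hxF⟩ ⟨_, hG, hcG, hxG⟩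
      have hmem : ({v, ℓ 0, ℓ j} : Finset V) ∈ faces := by
        by_contra hh
        exact hcon j ⟨htri, hh⟩
      obtain ⟨k, hk⟩ := (hF _).1 ⟨hmem, by simp⟩
      have m0 : ℓ 0 ∈ ({v, ℓ k, ℓ (k + 1)} : Finset V) := by rw [← hk]; simp
      have mj : ℓ j ∈ ({v, ℓ k, ℓ (k + 1)} : Finset V) := by rw [← hk]; simp
      simp only [Finset.mem_insert, Finset.mem_singleton, hne, false_or, hinj.eq_iff] at m0 mj
      have hj0 : j ≠ 0 := by rintro rfl; exact hxc rfl
      rcases m0 with h0 | h0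
      · left
        rcases mj with h | h
        · exact (hj0 (h.trans h0.symm)).elim
        · rw [h, ← h0, zero_add]
      · right
        rcases mj with h | h
        · rw [h]
          congr 1
          exact add_right_cancel (h0.symm.trans hlast.symm)
        · exact (hj0 (h.trans h0.symm)).elim
    · rintro ⟨k1, k2⟩
      apply hsphere
      have hn1 := hne 0
      have hn2 := hne 1
      have hn3 := hne ((d - 1 : ℕ) : ZMod d)
      generalize ℓ 0 = c at *
      generalize ℓ 1 = b at *
      generalize ℓ ((d - 1 : ℕ) : ZMod d) = e at *
      apply K4_euler T (K := {v, c, b, e})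
      · rw [Finset.card_insert_of_notMem (by simp; grind),
          Finset.card_eq_three.2 ⟨c, b, e, n01, n0l, n1l, rfl⟩]
      · intro t ht
        simp only [Finset.mem_insert, Finset.mem_singleton] at ht
        rcases ht with rfl | rfl | rfl | rfl
        · convert k2 using 1
          ext x; simp; grind
        · convert k1 using 1
          ext x; simp; grind
        · convert fe using 1
          ext x; simp; grind
        · convert fb using 1
          ext x; simp; grind
    · rw [show d - 2 + 1 = d - 1 by omega]
    · intro i hi
      have := hnat (i + 1) 0 (by omega) (by omega) (by omega)
      simpa using this
    · intro i hi
      have := hface ((i + 1 : ℕ) : ZMod d)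
      rwa [← Nat.cast_add_one] at this
    · intro i hi heq
      have : ℓ ((i + 1 : ℕ) : ZMod d) ∈
          ({v, ℓ ((i + 1 + 1 : ℕ) : ZMod d), ℓ ((i + 1 + 1 + 1 : ℕ) : ZMod d)} : Finset V) := by
        rw [← heq]; simp
      simp only [Finset.mem_insert, Finset.mem_singleton, hne, false_or] at this
      rcases this with h | h
      · exact hnat _ _ (by omega) (by omega) (by omega) h
      · exact hnat _ _ (by omega) (by omega) (by omega) h
  exact hirr _ X.contractible.1 ⟨_, _, rfl, X.contractible⟩

lemma exists_chord {faces : Finset (Finset V)} (h : IrreducibleTri faces)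
    (hsphere : eulerChar faces ≠ 2) {v : V} {d : ℕ} {ℓ : ZMod d → V}
    (hℓ : IsLink faces v d ℓ) (i : ZMod d) :
    ∃ j, IsNonfacialTriCycle faces {v, ℓ i, ℓ j} := by
  have hℓ' : IsLink faces v d (fun k => ℓ (k + i)) := by
    refine ⟨fun x y hxy => add_right_cancel (hℓ.1 hxy), fun k => hℓ.2.1 _, fun F => ?_⟩
    rw [hℓ.2.2 F]
    constructor
    · rintro ⟨k, rfl⟩
      exact ⟨k - i, by simp [add_right_comm]⟩
    · rintro ⟨k, rfl⟩
      exact ⟨k + i, by simp only [add_right_comm]⟩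
  obtain ⟨j, hj⟩ := exists_chord_zero h hsphere hℓ'
  exact ⟨j + i, by simpa using hj⟩

end Helpers

lemma crossing_chords (d : ℕ) (C : ℕ → ℕ → Prop) (hd : 0 < d) (hsymm : ∀ i j, C i j → C j i)
    (hirr : ∀ i, ¬ C i i) (hsucc : ∀ i, ¬ C i (i + 1)) (hex : ∀ i < d, ∃ j < d, C i j) :
    ∃ i j k l : ℕ, i < j ∧ j < k ∧ k < l ∧ l < d ∧ C i k ∧ C j l := by
  have main : ∀ m i k, i < k → k < d → k - i = m → C i k →
      ∃ i j k l : ℕ, i < j ∧ j < k ∧ k < l ∧ l < d ∧ C i k ∧ C j l := by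
    intro m
    induction m using Nat.strong_induction_on with
    | _ m ih =>
      intro i k hik hk hm hC
      have h1 : k ≠ i + 1 := by rintro rfl; exact hsucc i hC
      obtain ⟨j, hj, hCj⟩ := hex (i + 1) (by omega)
      have h2 : j ≠ i := by rintro rfl; exact hsucc _ (hsymm _ _ hCj)
      have h3 : j ≠ i + 1 := by rintro rfl; exact hirr _ hCj
      rcases lt_or_ge j i with h4 | h4
      · exact ⟨j, i, i + 1, k, h4, by omega, by omega, hk, hsymm _ _ hCj, hC⟩
      · rcases lt_or_ge k j with h5 | h5
        · exact ⟨i, i + 1, k, j, by omega, by omega, h5, hj, hC, hCj⟩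
        · exact ih (j - (i + 1)) (by omega) (i + 1) j (by omega) hj rfl hCj
  obtain ⟨j, hj, hC⟩ := hex 0 hd
  have : j ≠ 0 := by rintro rfl; exact hirr _ hC
  exact main _ 0 j (by omega) hj rfl hC

/-- combinatorial content of Theorem 1: in an irreducible triangulation
of a surface other than the sphere, every vertex `v` has four distinct neighbours
`y₁ y₂ y₃ y₄` in this cyclic order on lk(v) such that `v y₁ y₃` and `v y₂ y₄` are
nonfacial 3-cycles. -/
theorem stmt14 [DecidableEq V] (faces : Finset (Finset V)) (h : IrreducibleTri faces)
    (hsphere : eulerChar faces ≠ 2) (v : V) (hv : v ∈ vertexSet faces)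
    (d : ℕ) (ℓ : ZMod d → V) (hℓ : IsLink faces v d ℓ) :
    ∃ i j k l : ℕ, i < j ∧ j < k ∧ k < l ∧ l < d ∧
      IsNonfacialTriCycle faces {v, ℓ (i : ZMod d), ℓ (k : ZMod d)} ∧
      IsNonfacialTriCycle faces {v, ℓ (j : ZMod d), ℓ (l : ZMod d)} := by
  have hd := link_three_le h.1 hℓ
  have : NeZero d := ⟨by omega⟩
  apply crossing_chords d
    (fun i j => IsNonfacialTriCycle faces {v, ℓ (i : ZMod d), ℓ (j : ZMod d)}) (by omega)
  · intro i j hC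
    rwa [Finset.pair_comm]
  · intro i hC
    have h3 := hC.1.1
    have e1 : ({v, ℓ (i : ZMod d), ℓ (i : ZMod d)} : Finset V) = {v, ℓ (i : ZMod d)} := by
      ext; simp
    rw [e1] at h3
    have := Finset.card_le_two (a := v) (b := ℓ (i : ZMod d))
    omega
  · intro i hC
    apply hC.2
    have := ((hℓ.2.2 _).2 ⟨(i : ZMod d), rfl⟩).1
    rwa [← Nat.cast_add_one] at this
  · intro i _
    obtain ⟨j, hj⟩ := exists_chord h hsphere hℓ (i : ZMod d)
    exact ⟨j.val, ZMod.val_lt j, by simpa using hj⟩
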